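/- Let A ≥ p be a real number. Let (a_i)_{i≥0} be a sequence with a_0 ∈ S_p and a_i ∈ S'_p for all i ≥ 1 which is quasi-periodic with data (n_i), (λ_i), (k_i), is not ultimately periodic, and satisfies |a_i|_p ≤ A for every i. Suppose that for infinitely many i one has a_{n_i} = a_{n_i+1} = ⋯ = a_{n_i+k_i−1} = p − p^{−1}, and that liminf_{i→∞} λ_i/n_i > 2·log A/log p − 1. Then the value α of the infinite Ruban continued fraction [a_0, a_1, a_2, …] is transcendental over ℚ. -/

import Mathlib

open Filter Polynomial

/-- `S_p`: rationals `b` with `b·p^k ∈ ℤ` for some `k ≥ 0` and `0 ≤ b < p`. -/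
def Sp (p : ℕ) : Set ℚ :=
  {b : ℚ | (∃ k : ℕ, ∃ z : ℤ, (z : ℚ) = b * (p : ℚ) ^ k) ∧ 0 ≤ b ∧ b < (p : ℚ)}

/-- `S'_p`: elements of `S_p` with `|b|_p ≥ p`. -/
def Sp' (p : ℕ) : Set ℚ :=
  {b : ℚ | b ∈ Sp p ∧ (p : ℚ) ≤ padicNorm p b}

/-- Denominators of the convergents, with shifted index: `rubanQ a 0 = q_{-1} = 0`,
`rubanQ a 1 = q_0 = 1`, and `rubanQ a (n+1) = q_n = a_n q_{n-1} + q_{n-2}`. -/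
def rubanQ (a : ℕ → ℚ) : ℕ → ℚ
  | 0 => 0
  | 1 => 1
  | n + 2 => a (n + 1) * rubanQ a (n + 1) + rubanQ a n

/-- Numerators of the convergents, with shifted index: `rubanR a 0 = r_{-1} = 1`,
`rubanR a 1 = r_0 = a_0`, and `rubanR a (n+1) = r_n = a_n r_{n-1} + r_{n-2}`. -/
def rubanR (a : ℕ → ℚ) : ℕ → ℚ
  | 0 => 1
  | 1 => a 0
  | n + 2 => a (n + 1) * rubanR a (n + 1) + rubanR a n

/-- `α` is the value of the infinite Ruban continued fraction `[a_0, a_1, …]`, i.e. the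
limit in `ℚ_p` of the convergents `r_n / q_n`. -/
def IsRubanValue (p : ℕ) [Fact p.Prime] (a : ℕ → ℚ) (α : ℚ_[p]) : Prop :=
  Filter.Tendsto (fun n : ℕ => ((rubanR a (n + 1) / rubanQ a (n + 1) : ℚ) : ℚ_[p]))
    Filter.atTop (nhds α)

/-- A sequence is ultimately periodic if `a_{n+l} = a_n` for all `n ≥ k`,
for some `k ≥ 0`, `l ≥ 1`. -/
def UltimatelyPeriodic (a : ℕ → ℚ) : Prop :=
  ∃ k l : ℕ, 1 ≤ l ∧ ∀ n, k ≤ n → a (n + l) = a n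

/-! ### Taylor coefficients of multivariate polynomials -/

namespace Roth

open Finset

section Hasse

variable {σ R : Type*} [CommRing R]

/-- The substitution `X ↦ X + β`. -/
noncomputable def shift (β : σ → R) : MvPolynomial σ R →ₐ[R] MvPolynomial σ R :=
  MvPolynomial.aeval fun j => MvPolynomial.X j + MvPolynomial.C (β j)

lemma shift_shift (β γ : σ → R) (P : MvPolynomial σ R) :
    shift β (shift γ P) = shift (β + γ) P := by
  rw [← AlgHom.comp_apply]
  congr 1
  apply MvPolynomial.algHom_ext
  intro j
  simp [shift, add_assoc]

lemma shift_zero (P : MvPolynomial σ R) : shift 0 P = P := by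
  have : shift (0 : σ → R) = AlgHom.id R _ := by
    apply MvPolynomial.algHom_ext
    intro j
    simp [shift]
  rw [this, AlgHom.id_apply]

lemma shift_ne_zero (β : σ → R) {P : MvPolynomial σ R} (hP : P ≠ 0) : shift β P ≠ 0 := by
  intro h
  apply hP
  rw [← shift_zero P, ← neg_add_cancel β, ← shift_shift, h, map_zero]

lemma map_shift {S : Type*} [CommRing S] (f : R →+* S) (β : σ → R) (P : MvPolynomial σ R) :
    MvPolynomial.map f (shift β P) = shift (fun j => f (β j)) (MvPolynomial.map f P) := by
  rw [← RingHom.coe_coe (shift β), ← RingHom.coe_coe (shift fun j => f (β j)),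
    ← RingHom.comp_apply, ← RingHom.comp_apply]
  congr 1
  apply MvPolynomial.ringHom_ext <;> simp [shift]

variable [Fintype σ]

/-- The product of the binomial coefficients `(k j).choose (i j)`. -/
def mvChoose (k i : σ →₀ ℕ) : ℕ := ∏ j, (k j).choose (i j)

/-- The Hasse derivative `∂^μ / μ!` on multivariate polynomials. -/
noncomputable def hasse (μ : σ →₀ ℕ) (P : MvPolynomial σ R) : MvPolynomial σ R :=
  ∑ k ∈ P.support, MvPolynomial.monomial (k - μ) ((mvChoose k μ : R) * P.coeff k)

lemma mvChoose_eq_zero {k i : σ →₀ ℕ} (h : ¬ i ≤ k) : mvChoose k i = 0 := by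
  obtain ⟨j, hj⟩ : ∃ j, ¬ i j ≤ k j := by simpa [Finsupp.le_def] using h
  exact prod_eq_zero (mem_univ j) (Nat.choose_eq_zero_of_lt (not_le.mp hj))

lemma mvChoose_le (k i : σ →₀ ℕ) : mvChoose k i ≤ 2 ^ ∑ j, k j := by
  rw [← prod_pow_eq_pow_sum]
  exact prod_le_prod' fun j _ => Nat.choose_le_two_pow _ _

lemma mvChoose_mul (k μ i : σ →₀ ℕ) :
    mvChoose k μ * mvChoose (k - μ) i = mvChoose (i + μ) μ * mvChoose k (i + μ) := by
  simp only [mvChoose, ← prod_mul_distrib]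
  refine prod_congr rfl fun j _ => ?_
  simp only [Finsupp.coe_tsub, Pi.sub_apply, Finsupp.coe_add, Pi.add_apply]
  rw [mul_comm ((i j + μ j).choose _), Nat.choose_mul (Nat.le_add_left _ _)]
  simp

lemma coeff_hasse (μ i : σ →₀ ℕ) (P : MvPolynomial σ R) :
    (hasse μ P).coeff i = mvChoose (i + μ) μ * P.coeff (i + μ) := by
  classical
  rw [hasse, MvPolynomial.coeff_sum]
  simp only [MvPolynomial.coeff_monomial]
  rw [sum_eq_single (i + μ)]
  · simp
  · intro k _ hk
    split_ifs with h
    · have : ¬ μ ≤ k := fun h' => hk (by rw [← h, tsub_add_cancel_of_le h'])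
      simp [mvChoose_eq_zero this]
    · rfl
  · intro h
    simp [MvPolynomial.notMem_support_iff.mp h]

lemma map_hasse {S : Type*} [CommRing S] (f : R →+* S) (μ : σ →₀ ℕ) (P : MvPolynomial σ R) :
    MvPolynomial.map f (hasse μ P) = hasse μ (MvPolynomial.map f P) := by
  ext i
  simp [coeff_hasse, MvPolynomial.coeff_map]

lemma hasse_sum_mul {ι : Type*} (s : Finset ι) (c : ι → R) (μ : σ →₀ ℕ)
    (P : ι → MvPolynomial σ R) :
    hasse μ (∑ l ∈ s, MvPolynomial.C (c l) * P l) =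
      ∑ l ∈ s, MvPolynomial.C (c l) * hasse μ (P l) := by
  ext i
  simp only [coeff_hasse, MvPolynomial.coeff_sum, MvPolynomial.coeff_C_mul, mul_sum]
  exact sum_congr rfl fun l _ => by ring

lemma pderiv_hasse (j : σ) (μ : σ →₀ ℕ) (P : MvPolynomial σ R) :
    MvPolynomial.pderiv j (hasse μ P) =
      MvPolynomial.C ((μ j : R) + 1) * hasse (μ + Finsupp.single j 1) P := by
  classical
  ext i
  rw [MvPolynomial.coeff_pderiv, MvPolynomial.coeff_C_mul, coeff_hasse, coeff_hasse,
    show i + Finsupp.single j 1 + μ = i + (μ + Finsupp.single j 1) by abel]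
  suffices h : mvChoose (i + (μ + Finsupp.single j 1)) μ * (i j + 1) =
      (μ j + 1) * mvChoose (i + (μ + Finsupp.single j 1)) (μ + Finsupp.single j 1) by
    have h' := congrArg (Nat.cast : ℕ → R) h
    push_cast at h'
    linear_combination P.coeff (i + (μ + Finsupp.single j 1)) * h'
  simp only [mvChoose]
  rw [← mul_prod_erase _ _ (mem_univ j), ← mul_prod_erase univ
    (fun x => ((i + (μ + Finsupp.single j 1) : σ →₀ ℕ) x).choose
      ((μ + Finsupp.single j 1 : σ →₀ ℕ) x)) (mem_univ j)]
  have h1 : ∀ x ∈ univ.erase j, ((i + (μ + Finsupp.single j 1) : σ →₀ ℕ) x).choose (μ x) =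
      ((i + (μ + Finsupp.single j 1) : σ →₀ ℕ) x).choose ((μ + Finsupp.single j 1 : σ →₀ ℕ) x) := by
    intro x hx
    simp [(ne_of_mem_erase hx).symm]
  rw [prod_congr rfl h1]
  have h2 := Nat.choose_succ_right_eq (i j + (μ j + 1)) (μ j)
  rw [show i j + (μ j + 1) - μ j = i j + 1 by omega] at h2
  simp only [Finsupp.coe_add, Pi.add_apply, Finsupp.single_eq_same]
  linear_combination (∏ x ∈ univ.erase j, (i x + (μ x + (Finsupp.single j 1 : σ →₀ ℕ) x)).choose
    (μ x + (Finsupp.single j 1 : σ →₀ ℕ) x)) * h2.symm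

lemma coeff_prod_sum_monomial (q : σ → ℕ → R) (N : σ → ℕ) (i : σ →₀ ℕ) :
    (∏ j, ∑ a ∈ range (N j + 1), MvPolynomial.monomial (Finsupp.single j a) (q j a)).coeff i =
      ∏ j, if i j ≤ N j then q j (i j) else 0 := by
  classical
  have hmon : ∀ x : σ → ℕ, ∏ j, MvPolynomial.monomial (Finsupp.single j (x j)) (q j (x j)) =
      MvPolynomial.monomial (Finsupp.equivFunOnFinite.symm x) (∏ j, q j (x j)) := by
    intro x
    have : Finsupp.equivFunOnFinite.symm x = ∑ j, Finsupp.single j (x j) := by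
      ext a
      simp [Finsupp.single_apply, Finsupp.finsetSum_apply]
    rw [this, MvPolynomial.monomial_sum_index, map_prod, ← prod_mul_distrib]
    exact prod_congr rfl fun j _ => by rw [MvPolynomial.C_mul_monomial, mul_one]
  rw [prod_univ_sum, MvPolynomial.coeff_sum]
  simp only [hmon, MvPolynomial.coeff_monomial]
  by_cases h : ∀ j, i j ≤ N j
  · rw [sum_eq_single (⇑i)]
    · simp [h]
    · intro x _ hx
      rw [if_neg]
      intro h'
      exact hx (by rw [← h']; rfl)
    · intro h'
      exact absurd (by simpa [Fintype.mem_piFinset, Nat.lt_succ_iff] using h) h'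
  · push Not at h
    obtain ⟨j, hj⟩ := h
    rw [prod_eq_zero (mem_univ j) (by rw [if_neg (not_le.mpr hj)])]
    refine sum_eq_zero fun x hx => if_neg ?_
    rintro rfl
    have := Fintype.mem_piFinset.mp hx j
    simp only [mem_range] at this
    simp at hj
    omega

lemma coeff_shift (β : σ → R) (P : MvPolynomial σ R) (i : σ →₀ ℕ) :
    (shift β P).coeff i =
      ∑ k ∈ P.support, P.coeff k * ((mvChoose k i : R) * ∏ j, β j ^ (k j - i j)) := by
  conv_lhs => rw [P.as_sum]
  rw [map_sum, MvPolynomial.coeff_sum]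
  refine sum_congr rfl fun k _ => ?_
  rw [shift, MvPolynomial.aeval_monomial, Finsupp.prod_fintype _ _ (by simp),
    MvPolynomial.algebraMap_eq, MvPolynomial.coeff_C_mul]
  congr 1
  have : ∀ j, (MvPolynomial.X j + MvPolynomial.C (β j) : MvPolynomial σ R) ^ k j =
      ∑ a ∈ range (k j + 1), MvPolynomial.monomial (Finsupp.single j a)
        (β j ^ (k j - a) * ((k j).choose a : R)) := by
    intro j
    rw [add_pow]
    refine sum_congr rfl fun a _ => ?_
    rw [MvPolynomial.X_pow_eq_monomial, ← map_pow, mul_assoc, ← map_natCast MvPolynomial.C,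
      ← map_mul, mul_comm, MvPolynomial.C_mul_monomial, mul_one]
  simp only [this]
  rw [coeff_prod_sum_monomial, mvChoose, Nat.cast_prod, ← prod_mul_distrib]
  refine prod_congr rfl fun j _ => ?_
  split_ifs with h
  · ring
  · simp [Nat.choose_eq_zero_of_lt (not_le.mp h)]

lemma coeff_shift_of_subset (β : σ → R) (P : MvPolynomial σ R) (i : σ →₀ ℕ)
    {s : Finset (σ →₀ ℕ)} (hs : P.support ⊆ s) :
    (shift β P).coeff i =
      ∑ k ∈ s, P.coeff k * ((mvChoose k i : R) * ∏ j, β j ^ (k j - i j)) := by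
  rw [coeff_shift]
  refine sum_subset hs fun k _ hk => ?_
  rw [MvPolynomial.notMem_support_iff.mp hk, zero_mul]

lemma coeff_shift_hasse (β : σ → R) (μ i : σ →₀ ℕ) (P : MvPolynomial σ R) :
    (shift β (hasse μ P)).coeff i = mvChoose (i + μ) μ * (shift β P).coeff (i + μ) := by
  classical
  have key : ∀ k, (shift β (MvPolynomial.monomial (k - μ) ((mvChoose k μ : R) * P.coeff k))).coeff i
      = mvChoose (i + μ) μ * (P.coeff k * ((mvChoose k (i + μ) : R) *
        ∏ j, β j ^ (k j - (i + μ) j))) := by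
    intro k
    rw [coeff_shift_of_subset β _ i MvPolynomial.support_monomial_subset, sum_singleton,
      MvPolynomial.coeff_monomial, if_pos rfl]
    have h := congrArg (Nat.cast : ℕ → R) (mvChoose_mul k μ i)
    push_cast at h
    have h2 : ∏ j, β j ^ ((k - μ) j - i j) = ∏ j, β j ^ (k j - (i + μ) j) :=
      prod_congr rfl fun j _ => by
        rw [Finsupp.tsub_apply, Finsupp.add_apply, Nat.sub_sub, add_comm (i j)]
    rw [h2]
    linear_combination P.coeff k * (∏ j, β j ^ (k j - (i + μ) j)) * h
  rw [hasse, map_sum, MvPolynomial.coeff_sum, coeff_shift, mul_sum]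
  exact sum_congr rfl fun k _ => key k

lemma eval_hasse (β : σ → R) (μ : σ →₀ ℕ) (P : MvPolynomial σ R) :
    MvPolynomial.eval β (hasse μ P) = (shift β P).coeff μ := by
  have h1 : (shift β (hasse μ P)).coeff 0 = MvPolynomial.eval β (hasse μ P) := by
    rw [← MvPolynomial.constantCoeff_eq, ← RingHom.coe_coe (shift β), ← RingHom.comp_apply]
    congr 1
    apply MvPolynomial.ringHom_ext <;> simp [shift]
  rw [← h1, coeff_shift_hasse]
  simp [mvChoose]

end Hasse

end Roth

/-! ### Generalized Wronskians -/

namespace Roth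

open Finset

section Wronskian

/-- A generalized Wronskian criterion: if no nonzero vector annihilates all the derived vectors
`v i`, then some square matrix formed from derived vectors of order less than its size is
nonsingular. -/
theorem exists_wronskian_ne_zero {R κ I J : Type*} [CommRing R] [IsDomain R] [Fintype κ]
    [DecidableEq κ] (v : I → κ → R) (deg : I → ℕ) (D : J → Derivation ℤ R R) (succ : J → I → I)
    (a : J → I → R) (ha : ∀ j i, a j i ≠ 0)
    (hD : ∀ j i l, D j (v i l) = a j i * v (succ j i) l)
    (hdeg : ∀ j i, deg (succ j i) = deg i + 1)
    (hsucc : ∀ i, deg i ≠ 0 → ∃ j i', i = succ j i')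
    (hv : ∀ c : κ → R, (∀ i, ∑ l, c l * v i l = 0) → c = 0) :
    ∃ w : κ → I, (∀ k, deg (w k) < Fintype.card κ) ∧
      (Matrix.of fun k l => v (w k) l).det ≠ 0 := by
  classical
  let F := FractionRing R
  let φ : R →+* F := algebraMap R F
  have hφ : Function.Injective φ := IsFractionRing.injective R F
  let A : ℕ → Submodule F (κ → F) := fun l =>
    { carrier := {c | ∀ i, deg i < l → ∑ k, c k * φ (v i k) = 0}
      add_mem' := fun {x y} hx hy i hi => by
        simp only [Pi.add_apply, add_mul, sum_add_distrib, hx i hi, hy i hi, add_zero]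
      zero_mem' := fun i _ => by simp
      smul_mem' := fun t x hx i hi => by
        simp only [Pi.smul_apply, smul_eq_mul, mul_assoc, ← mul_sum, hx i hi, mul_zero] }
  have hA : ∀ l c, c ∈ A l ↔ ∀ i, deg i < l → ∑ k, c k * φ (v i k) = 0 := fun l c => Iff.rfl
  have hAR : ∀ l (c : κ → R), (fun k => φ (c k)) ∈ A l ↔ ∀ i, deg i < l → ∑ k, c k * v i k = 0 := by
    intro l c
    rw [hA]
    refine forall₂_congr fun i _ => ?_
    rw [← map_eq_zero_iff φ hφ, map_sum]
    simp only [map_mul]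
  have hclear : ∀ c : κ → F, ∃ d : F, d ≠ 0 ∧ ∃ c' : κ → R, d • c = fun k => φ (c' k) := by
    intro c
    obtain ⟨b, hb⟩ := IsLocalization.exist_integer_multiples_of_finite (nonZeroDivisors R) c
    choose c' hc' using hb
    refine ⟨φ b, (map_ne_zero_iff φ hφ).mpr (nonZeroDivisors.ne_zero b.2), c', ?_⟩
    ext k
    rw [hc' k, Algebra.smul_def (b : R)]
    rfl
  have hanti : ∀ l, A (l + 1) ≤ A l := fun l c hc i hi => hc i (by omega)
  have hstep : ∀ l, A l ≤ A (l + 1) → A (l + 1) ≤ A (l + 2) := by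
    intro l hl c hc
    obtain ⟨d, hd, c', hc'⟩ := hclear c
    rw [← Submodule.smul_mem_iff _ hd, hc']
    have hc1 : (fun k => φ (c' k)) ∈ A (l + 1) := hc' ▸ Submodule.smul_mem _ _ hc
    rw [hAR] at hc1
    have hder : ∀ j i, deg i < l + 1 → ∑ k, D j (c' k) * v i k =
        -(a j i * ∑ k, c' k * v (succ j i) k) := by
      intro j i hi
      have := congrArg (D j) (hc1 i hi)
      rw [map_sum, map_zero] at this
      simp only [Derivation.leibniz, hD, smul_eq_mul, sum_add_distrib] at this
      rw [mul_sum, eq_neg_iff_add_eq_zero, ← this, add_comm]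
      congr 1
      · exact sum_congr rfl fun k _ => by ring
      · exact sum_congr rfl fun k _ => by ring
    have hDc : ∀ j, (fun k => φ (D j (c' k))) ∈ A (l + 1) := by
      intro j
      apply hl
      rw [hAR]
      intro i hi
      rw [hder j i (by omega), hc1 _ (by rw [hdeg]; omega), mul_zero, neg_zero]
    rw [hAR]
    intro i hi
    by_cases h0 : deg i = 0
    · exact hc1 i (by omega)
    · obtain ⟨j, i', rfl⟩ := hsucc i h0
      rw [hdeg] at hi
      have h1 := (hAR _ _).mp (hDc j) i' (by omega)
      rw [hder j i' (by omega), neg_eq_zero] at h1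
      exact (mul_eq_zero.mp h1).resolve_left (ha j i')
  have hstable : ∀ l, A l ≤ A (l + 1) → A l = ⊥ := by
    intro l hl
    have hs : ∀ m, A (l + m) ≤ A (l + m + 1) := by
      intro m
      induction m with
      | zero => exact hl
      | succ m ih => exact hstep _ ih
    have hall : ∀ m, A l ≤ A (l + m) := by
      intro m
      induction m with
      | zero => exact le_rfl
      | succ m ih => exact ih.trans (hs m)
    rw [eq_bot_iff]
    intro c hc
    obtain ⟨d, hd, c', hc'⟩ := hclear c
    have h0 : c' = 0 := by
      refine hv c' fun i => ?_
      have h1 : (fun k => φ (c' k)) ∈ A (l + (deg i + 1)) :=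
        hc' ▸ Submodule.smul_mem _ _ (hall _ hc)
      exact (hAR _ _).mp h1 i (by omega)
    rw [h0] at hc'
    have : d • c = 0 := by rw [hc']; ext k; simp
    exact (smul_eq_zero.mp this).resolve_left hd
  have hrank : ∀ l, A l = ⊥ ∨ Module.finrank F (A l) + l ≤ Fintype.card κ := by
    intro l
    induction l with
    | zero =>
      right
      simpa using Submodule.finrank_le (A 0)
    | succ l ih =>
      rcases ih with h | h
      · left
        exact eq_bot_iff.mpr ((hanti l).trans h.le)
      · by_cases hl : A l ≤ A (l + 1)
        · left
          exact eq_bot_iff.mpr ((hanti l).trans (hstable l hl).le)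
        · right
          have := Submodule.finrank_lt_finrank_of_lt (lt_of_le_not_ge (hanti l) hl)
          omega
  have hbot : A (Fintype.card κ) = ⊥ := by
    rcases hrank (Fintype.card κ) with h | h
    · exact h
    · exact Submodule.finrank_eq_zero.mp (by omega)
  let u : {i // deg i < Fintype.card κ} → (κ → F) := fun i k => φ (v i k)
  have hspan : Submodule.span F (Set.range u) = ⊤ := by
    by_contra hne
    obtain ⟨f, hf, hle⟩ := Submodule.exists_le_ker_of_lt_top _ (lt_top_iff_ne_top.mpr hne)
    apply hf
    have hfc : ∀ x, f x = ∑ k, f (Pi.single k 1) * x k := by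
      intro x
      conv_lhs => rw [pi_eq_sum_univ' x]
      rw [map_sum]
      refine sum_congr rfl fun k _ => ?_
      rw [map_smul, smul_eq_mul, mul_comm]
    have hmem : (fun k => f (Pi.single k 1)) ∈ A (Fintype.card κ) := by
      intro i hi
      rw [← hfc]
      exact hle (Submodule.subset_span ⟨⟨i, hi⟩, rfl⟩)
    rw [hbot, Submodule.mem_bot] at hmem
    ext x
    simp [congrFun hmem x]
  obtain ⟨κ', b, -, hb, hli⟩ := exists_linearIndependent' F u
  rw [hspan] at hb
  let B := Module.Basis.mk hli hb.ge
  have : Finite κ' := Module.Finite.finite_basis B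
  have := Fintype.ofFinite κ'
  have hcard : Fintype.card κ = Fintype.card κ' := by
    rw [← Module.finrank_eq_card_basis B, Module.finrank_fintype_fun_eq_card]
  let e := Fintype.equivOfCardEq hcard
  refine ⟨fun k => b (e k), fun k => (b (e k)).2, fun h => ?_⟩
  have hli' : LinearIndependent F (Matrix.of fun k l => φ (v (b (e k)) l)).row :=
    hli.comp e e.injective
  rw [Matrix.linearIndependent_rows_iff_isUnit, Matrix.isUnit_iff_isUnit_det, isUnit_iff_ne_zero]
    at hli'
  apply hli'
  have h' := congrArg φ h
  rwa [RingHom.map_det, map_zero] at h'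

end Wronskian

end Roth

/-! ### Wronskians, lengths and orders of vanishing -/

namespace Roth

open Finset

section WronskianPolynomial

lemma exists_det_hasse_ne_zero {σ κ : Type*} [Fintype σ] [Fintype κ] [DecidableEq κ]
    {φ : κ → MvPolynomial σ ℚ} (hφ : LinearIndependent ℚ φ) :
    ∃ μ : κ → σ →₀ ℕ, (∀ a, ∑ j, μ a j < Fintype.card κ) ∧
      (Matrix.of fun a l => hasse (μ a) (φ l)).det ≠ 0 := by
  classical
  refine exists_wronskian_ne_zero (fun (μ : σ →₀ ℕ) l => hasse μ (φ l)) (fun μ => ∑ j, μ j)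
    (fun j => (MvPolynomial.pderiv j).restrictScalars ℤ) (fun j μ => μ + Finsupp.single j 1)
    (fun j μ => MvPolynomial.C ((μ j : ℚ) + 1)) (fun j μ => ?_) (fun j μ l => ?_) (fun j μ => ?_)
    (fun μ hμ => ?_) (fun c hc => ?_)
  · rw [Ne, MvPolynomial.C_eq_zero]
    positivity
  · exact pderiv_hasse j μ (φ l)
  · simp [sum_add_distrib, Finsupp.single_apply]
  · obtain ⟨j, -, hj⟩ := exists_ne_zero_of_sum_ne_zero hμ
    refine ⟨j, μ - Finsupp.single j 1, (tsub_add_cancel_of_le ?_).symm⟩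
    simpa using Nat.one_le_iff_ne_zero.mpr hj
  · by_contra hne
    obtain ⟨l₀, hl₀⟩ := Function.ne_iff.mp hne
    obtain ⟨x, hx⟩ : ∃ x, MvPolynomial.eval x (c l₀) ≠ 0 := by
      by_contra! h
      exact hl₀ (MvPolynomial.funext fun x => by simp [h x])
    apply hx
    have h0 : shift x (∑ l, MvPolynomial.C (MvPolynomial.eval x (c l)) * φ l) = 0 := by
      ext i
      rw [← eval_hasse, hasse_sum_mul, map_sum, MvPolynomial.coeff_zero]
      have := congrArg (MvPolynomial.eval x) (hc i)
      simpa using this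
    have h1 : ∑ l, MvPolynomial.eval x (c l) • φ l = 0 := by
      by_contra h
      refine shift_ne_zero x h ?_
      simpa [MvPolynomial.smul_eq_C_mul] using h0
    exact Fintype.linearIndependent_iff.mp hφ _ h1 l₀

lemma exists_det_hasseDeriv_ne_zero {κ : Type*} [Fintype κ] [DecidableEq κ]
    {ψ : κ → ℚ[X]} (hψ : LinearIndependent ℚ ψ) :
    ∃ ν : κ → ℕ, Function.Injective ν ∧ (∀ a, ν a < Fintype.card κ) ∧
      (Matrix.of fun a l => hasseDeriv (ν a) (ψ l)).det ≠ 0 := by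
  have key : ∃ ν : κ → ℕ, (∀ a, ν a < Fintype.card κ) ∧
      (Matrix.of fun a l => hasseDeriv (ν a) (ψ l)).det ≠ 0 := by
    refine exists_wronskian_ne_zero (fun (ν : ℕ) l => hasseDeriv ν (ψ l)) id
      (fun _ : Unit => derivative'.restrictScalars ℤ) (fun _ ν => ν + 1)
      (fun _ ν => C ((ν : ℚ) + 1)) (fun _ ν => ?_) (fun _ ν l => ?_) (fun _ ν => rfl)
      (fun ν hν => ?_) (fun c hc => ?_)
    · rw [Ne, C_eq_zero]
      positivity
    · change derivative (hasseDeriv ν (ψ l)) = _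
      ext i
      rw [coeff_derivative, coeff_C_mul, hasseDeriv_coeff, hasseDeriv_coeff,
        show i + 1 + ν = i + (ν + 1) by ring]
      have := Nat.choose_succ_right_eq (i + (ν + 1)) ν
      rw [show i + (ν + 1) - ν = i + 1 by omega] at this
      have := congrArg (Nat.cast : ℕ → ℚ) this
      push_cast at this
      linear_combination (-(ψ l).coeff (i + (ν + 1))) * this
    · exact ⟨(), ν - 1, (Nat.succ_pred_eq_of_ne_zero hν).symm⟩
    · by_contra hne
      obtain ⟨l₀, hl₀⟩ := Function.ne_iff.mp hne
      obtain ⟨x, hx⟩ : ∃ x, (c l₀).eval x ≠ 0 := by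
        by_contra! h
        exact hl₀ (Polynomial.funext fun x => by simp [h x])
      apply hx
      have h0 : taylor x (∑ l, (c l).eval x • ψ l) = 0 := by
        ext i
        rw [taylor_coeff, map_sum, eval_finsetSum, coeff_zero]
        have := congrArg (eval x) (hc i)
        rw [eval_finsetSum] at this
        simpa using this
      have h1 : ∑ l, (c l).eval x • ψ l = 0 :=
        taylor_injective x (by rw [h0, map_zero])
      exact Fintype.linearIndependent_iff.mp hψ _ h1 l₀
  obtain ⟨ν, hν, hdet⟩ := key
  refine ⟨ν, fun a b hab => ?_, hν, hdet⟩
  by_contra hne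
  exact hdet (Matrix.det_zero_of_row_eq hne (by ext l; simp [hab]))

end WronskianPolynomial

section Length

variable {σ : Type*}

/-- The sum of the absolute values of the coefficients. -/
def len (P : MvPolynomial σ ℤ) : ℕ := ∑ k ∈ P.support, (P.coeff k).natAbs

lemma len_eq_sum {P : MvPolynomial σ ℤ} {s : Finset (σ →₀ ℕ)} (hs : P.support ⊆ s) :
    len P = ∑ k ∈ s, (P.coeff k).natAbs :=
  sum_subset hs fun k _ hk => by simp [MvPolynomial.notMem_support_iff.mp hk]

lemma len_zero : len (0 : MvPolynomial σ ℤ) = 0 := by simp [len]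

lemma len_monomial_le (k : σ →₀ ℕ) (c : ℤ) : len (MvPolynomial.monomial k c) ≤ c.natAbs := by
  classical
  rw [len_eq_sum MvPolynomial.support_monomial_subset, sum_singleton, MvPolynomial.coeff_monomial,
    if_pos rfl]

lemma len_one_le : len (1 : MvPolynomial σ ℤ) ≤ 1 := by
  simpa using len_monomial_le (0 : σ →₀ ℕ) 1

lemma len_neg (P : MvPolynomial σ ℤ) : len (-P) = len P := by simp [len]

lemma len_add_le (P Q : MvPolynomial σ ℤ) : len (P + Q) ≤ len P + len Q := by
  classical
  rw [len_eq_sum MvPolynomial.support_add, len_eq_sum (P := P) subset_union_left,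
    len_eq_sum (P := Q) subset_union_right, ← sum_add_distrib]
  exact sum_le_sum fun k _ => by rw [MvPolynomial.coeff_add]; exact Int.natAbs_add_le _ _

lemma len_sum_le {ι : Type*} (s : Finset ι) (f : ι → MvPolynomial σ ℤ) :
    len (∑ i ∈ s, f i) ≤ ∑ i ∈ s, len (f i) :=
  le_sum_of_subadditive len len_zero.le len_add_le s f

lemma len_mul_le (P Q : MvPolynomial σ ℤ) : len (P * Q) ≤ len P * len Q := by
  have : P * Q = ∑ k ∈ P.support, ∑ l ∈ Q.support,
      MvPolynomial.monomial (k + l) (P.coeff k * Q.coeff l) := by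
    conv_lhs => rw [P.as_sum, Q.as_sum, sum_mul_sum]
    simp only [MvPolynomial.monomial_mul]
  have hlen : len P * len Q =
      ∑ k ∈ P.support, ∑ l ∈ Q.support, (P.coeff k).natAbs * (Q.coeff l).natAbs :=
    sum_mul_sum _ _ _ _
  rw [this, hlen]
  refine (len_sum_le _ _).trans (sum_le_sum fun k _ => (len_sum_le _ _).trans
    (sum_le_sum fun l _ => ?_))
  rw [← Int.natAbs_mul]
  exact len_monomial_le _ _

lemma len_prod_le {ι : Type*} (s : Finset ι) (f : ι → MvPolynomial σ ℤ) :
    len (∏ i ∈ s, f i) ≤ ∏ i ∈ s, len (f i) := by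
  classical
  induction s using Finset.induction_on with
  | empty => simpa using len_one_le
  | insert a s ha ih =>
    rw [prod_insert ha, prod_insert ha]
    exact (len_mul_le _ _).trans (Nat.mul_le_mul_left _ ih)

lemma len_det_le {κ : Type*} [Fintype κ] [DecidableEq κ] (M : Matrix κ κ (MvPolynomial σ ℤ))
    {B : ℕ} (hB : ∀ a b, len (M a b) ≤ B) :
    len M.det ≤ (Fintype.card κ).factorial * B ^ Fintype.card κ := by
  rw [Matrix.det_apply]
  refine (len_sum_le _ _).trans ?_
  have : ∀ τ ∈ (univ : Finset (Equiv.Perm κ)), len (Equiv.Perm.sign τ • ∏ b, M (τ b) b) ≤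
      B ^ Fintype.card κ := by
    intro τ _
    have h : len (∏ b, M (τ b) b) ≤ B ^ Fintype.card κ :=
      (len_prod_le _ _).trans ((prod_le_prod' fun b _ => hB _ b).trans (by simp))
    rcases Int.units_eq_one_or (Equiv.Perm.sign τ) with hs | hs <;> rw [hs]
    · simpa using h
    · simpa [len_neg] using h
  exact (sum_le_card_nsmul _ _ _ this).trans (by simp [Fintype.card_perm])

lemma one_le_len {P : MvPolynomial σ ℤ} (hP : P ≠ 0) : 1 ≤ len P := by
  obtain ⟨k, hk⟩ := MvPolynomial.ne_zero_iff.mp hP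
  exact (Int.natAbs_pos.mpr hk).trans_le
    (single_le_sum (f := fun k => (P.coeff k).natAbs) (fun _ _ => Nat.zero_le _)
      (MvPolynomial.mem_support_iff.mpr hk))

lemma natAbs_coeff_le_len (P : MvPolynomial σ ℤ) (k : σ →₀ ℕ) : (P.coeff k).natAbs ≤ len P := by
  by_cases hk : P.coeff k = 0
  · simp [hk]
  · exact single_le_sum (f := fun k => (P.coeff k).natAbs) (fun _ _ => Nat.zero_le _)
      (MvPolynomial.mem_support_iff.mpr hk)

end Length

section BoxOrd

variable {σ R : Type*} [CommRing R]

/-- The degree of `P` in the variable `j` is at most `r j`. -/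
def Box (r : σ → ℕ) (P : MvPolynomial σ R) : Prop := ∀ k, P.coeff k ≠ 0 → ∀ j, k j ≤ r j

/-- The weighted order of vanishing of `P` at the origin is at least `θ`. -/
def Ord [Fintype σ] (w : σ → ℝ) (θ : ℝ) (P : MvPolynomial σ R) : Prop :=
  ∀ k, P.coeff k ≠ 0 → θ ≤ ∑ j, w j * k j

lemma exists_coeff_ne_zero_of_prod {ι : Type*} (s : Finset ι) (f : ι → MvPolynomial σ R) :
    ∀ k, (∏ i ∈ s, f i).coeff k ≠ 0 →
      ∃ x : ι → σ →₀ ℕ, k = ∑ i ∈ s, x i ∧ ∀ i ∈ s, (f i).coeff (x i) ≠ 0 := by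
  classical
  induction s using Finset.induction_on with
  | empty =>
    intro k hk
    refine ⟨0, ?_, by simp⟩
    rw [prod_empty, MvPolynomial.coeff_one] at hk
    have : (0 : σ →₀ ℕ) = k := by
      by_contra h
      simp [h] at hk
    simp [← this]
  | insert a s ha ih =>
    intro k hk
    rw [prod_insert ha, MvPolynomial.coeff_mul] at hk
    obtain ⟨⟨u, v⟩, huv, hne⟩ := exists_ne_zero_of_sum_ne_zero hk
    obtain ⟨x, hx, hx'⟩ := ih v (right_ne_zero_of_mul hne)
    have hxa : ∀ i ∈ s, Function.update x a u i = x i := fun i hi =>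
      Function.update_of_ne (ne_of_mem_of_not_mem hi ha) _ _
    refine ⟨Function.update x a u, ?_, ?_⟩
    · rw [sum_insert ha, Function.update_self, sum_congr rfl hxa, ← hx]
      exact (mem_antidiagonal.mp huv).symm
    · intro i hi
      rcases mem_insert.mp hi with rfl | hi
      · simpa using left_ne_zero_of_mul hne
      · rw [hxa i hi]
        exact hx' i hi

lemma exists_coeff_ne_zero_of_det {κ : Type*} [Fintype κ] [DecidableEq κ]
    (M : Matrix κ κ (MvPolynomial σ R)) (k : σ →₀ ℕ) (hk : M.det.coeff k ≠ 0) :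
    ∃ (τ : Equiv.Perm κ) (x : κ → σ →₀ ℕ), k = ∑ b, x b ∧ ∀ b, (M (τ b) b).coeff (x b) ≠ 0 := by
  rw [Matrix.det_apply, MvPolynomial.coeff_sum] at hk
  obtain ⟨τ, -, hτ⟩ := exists_ne_zero_of_sum_ne_zero hk
  have : (∏ b, M (τ b) b).coeff k ≠ 0 := by
    intro h
    apply hτ
    rcases Int.units_eq_one_or (Equiv.Perm.sign τ) with hs | hs <;> simp [hs, h]
  obtain ⟨x, hx, hx'⟩ := exists_coeff_ne_zero_of_prod _ _ k this
  exact ⟨τ, x, hx, fun b => hx' b (mem_univ b)⟩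

lemma Box.det {κ : Type*} [Fintype κ] [DecidableEq κ] {M : Matrix κ κ (MvPolynomial σ R)}
    {r : σ → ℕ} (hM : ∀ a b, Box r (M a b)) : Box (fun j => Fintype.card κ * r j) M.det := by
  intro k hk j
  obtain ⟨τ, x, rfl, hx⟩ := exists_coeff_ne_zero_of_det M k hk
  rw [Finsupp.finsetSum_apply]
  exact (sum_le_card_nsmul _ _ _ fun b _ => hM _ _ _ (hx b) j).trans (by simp)

variable [Fintype σ]

lemma Ord.mono {w : σ → ℝ} {θ θ' : ℝ} {P : MvPolynomial σ R} (h : Ord w θ P) (hθ : θ' ≤ θ) :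
    Ord w θ' P := fun k hk => hθ.trans (h k hk)

lemma Ord.det {κ : Type*} [Fintype κ] [DecidableEq κ] {M : Matrix κ κ (MvPolynomial σ R)}
    {w : σ → ℝ} {θ : κ → ℝ} (hM : ∀ a b, Ord w (θ a) (M a b)) : Ord w (∑ a, θ a) M.det := by
  intro k hk
  obtain ⟨τ, x, rfl, hx⟩ := exists_coeff_ne_zero_of_det M k hk
  simp only [Finsupp.finsetSum_apply, Nat.cast_sum, mul_sum]
  rw [sum_comm, ← Equiv.sum_comp τ]
  exact sum_le_sum fun b _ => hM _ _ _ (hx b)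

lemma Box.hasse {r : σ → ℕ} {P : MvPolynomial σ R} (h : Box r P) (μ : σ →₀ ℕ) :
    Box r (hasse μ P) := by
  intro k hk j
  rw [coeff_hasse] at hk
  exact (Nat.le_add_right _ _).trans (h _ (right_ne_zero_of_mul hk) j)

lemma Ord.shift_hasse {w : σ → ℝ} {θ : ℝ} {β : σ → R} {P : MvPolynomial σ R}
    (h : Ord w θ (shift β P)) (μ : σ →₀ ℕ) :
    Ord w (θ - ∑ j, w j * μ j) (shift β (Roth.hasse μ P)) := by
  intro k hk
  rw [coeff_shift_hasse] at hk
  have := h _ (right_ne_zero_of_mul hk)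
  simp only [Finsupp.add_apply, Nat.cast_add, mul_add, sum_add_distrib] at this
  linarith

lemma len_hasse_le {r : σ → ℕ} {P : MvPolynomial σ ℤ} (h : Box r P) (μ : σ →₀ ℕ) :
    len (Roth.hasse μ P) ≤ 2 ^ (∑ j, r j) * len P := by
  have hlen : 2 ^ (∑ j, r j) * len P =
      ∑ k ∈ P.support, 2 ^ (∑ j, r j) * (P.coeff k).natAbs := mul_sum _ _ _
  rw [Roth.hasse, hlen]
  refine (len_sum_le _ _).trans (sum_le_sum fun k hk => (len_monomial_le _ _).trans ?_)
  rw [Int.natAbs_mul]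
  refine Nat.mul_le_mul_right _ ?_
  simp only [Int.natAbs_natCast]
  refine (mvChoose_le k μ).trans (Nat.pow_le_pow_right (by norm_num) (sum_le_sum fun j _ => ?_))
  exact h k (MvPolynomial.mem_support_iff.mp hk) j

end BoxOrd

end Roth

/-! ### Splitting off one variable -/

namespace Roth

open Finset

section Split

variable {R : Type*} [CommRing R] {n : ℕ}

/-- A univariate polynomial, viewed as a polynomial in the first variable. -/
noncomputable def inFst (n : ℕ) : R[X] →ₐ[R] MvPolynomial (Fin (n + 1)) R :=
  Polynomial.aeval (MvPolynomial.X 0)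

/-- A polynomial in `n` variables, viewed as a polynomial in the last `n` variables. -/
noncomputable def inTail : MvPolynomial (Fin n) R →ₐ[R] MvPolynomial (Fin (n + 1)) R :=
  MvPolynomial.rename Fin.succ

lemma coeff_inFst_mul_inTail (ψ : R[X]) (φ : MvPolynomial (Fin n) R) (k : Fin (n + 1) →₀ ℕ) :
    (inFst n ψ * inTail φ).coeff k = ψ.coeff (k 0) * φ.coeff k.tail := by
  have h1 : MvPolynomial.finSuccEquiv R n (inFst n ψ) = ψ.map MvPolynomial.C := by
    induction ψ using Polynomial.induction_on' with
    | add p q hp hq => simp [hp, hq]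
    | monomial m c =>
      simp [inFst, ← Polynomial.C_mul_X_pow_eq_monomial,
        MvPolynomial.finSuccEquiv_X_zero, MvPolynomial.algebraMap_eq]
      simp [MvPolynomial.finSuccEquiv_apply]
  have h2 : MvPolynomial.finSuccEquiv R n (inTail φ) = Polynomial.C φ := by
    rw [inTail, MvPolynomial.finSuccEquiv_apply]
    simp only [MvPolynomial.coe_eval₂Hom, MvPolynomial.eval₂_rename]
    induction φ using MvPolynomial.induction_on with
    | C a => simp
    | add p q hp hq => simp [hp, hq]
    | mul_X p j hp => simp [hp]
  conv_lhs => rw [← Finsupp.cons_tail k]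
  rw [← MvPolynomial.finSuccEquiv_coeff_coeff, map_mul, h1, h2, Polynomial.coeff_mul_C,
    Polynomial.coeff_map, MvPolynomial.coeff_C_mul]

lemma mvChoose_cons (k i : Fin (n + 1) →₀ ℕ) :
    mvChoose k i = (k 0).choose (i 0) * mvChoose k.tail i.tail := by
  simp [mvChoose, Fin.prod_univ_succ, Finsupp.tail_apply]

lemma hasse_inFst_mul_inTail (ν : ℕ) (μ : Fin n →₀ ℕ) (ψ : R[X]) (φ : MvPolynomial (Fin n) R) :
    hasse (μ.cons ν) (inFst n ψ * inTail φ) = inFst n (hasseDeriv ν ψ) * inTail (hasse μ φ) := by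
  ext k
  have ht : (k + μ.cons ν).tail = k.tail + μ := by
    ext j
    simp [Finsupp.tail_apply]
  rw [coeff_hasse, coeff_inFst_mul_inTail, coeff_inFst_mul_inTail, hasseDeriv_coeff, coeff_hasse,
    mvChoose_cons, ht]
  simp only [Finsupp.add_apply, Finsupp.cons_zero, Finsupp.tail_cons]
  push_cast
  ring

lemma shift_inFst (β : Fin (n + 1) → R) (ψ : R[X]) :
    shift β (inFst n ψ) = inFst n (taylor (β 0) ψ) := by
  have : (shift β).comp (inFst n) = (inFst n).comp (taylorAlgHom (β 0)) := by
    ext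
    simp [shift, inFst, MvPolynomial.algebraMap_eq]
  exact DFunLike.congr_fun this ψ

lemma shift_inTail (β : Fin (n + 1) → R) (φ : MvPolynomial (Fin n) R) :
    shift β (inTail φ) = inTail (shift (fun j => β j.succ) φ) := by
  have : (shift β).comp inTail = inTail.comp (shift fun j => β j.succ) := by
    apply MvPolynomial.algHom_ext
    simp [shift, inTail]
  exact DFunLike.congr_fun this φ

end Split

/-- Separation of the first variable in a generalized Wronskian. -/
lemma exists_det_hasse_eq_mul {n : ℕ} {F : MvPolynomial (Fin (n + 1)) ℚ} (hF : F ≠ 0)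
    {r : Fin (n + 1) → ℕ} (hr : Box r F) :
    ∃ (κ : Type) (_ : Fintype κ) (_ : DecidableEq κ) (ν : κ → ℕ) (μ : κ → Fin n →₀ ℕ)
      (V : ℚ[X]) (U : MvPolynomial (Fin n) ℚ),
      0 < Fintype.card κ ∧ Fintype.card κ ≤ r 0 + 1 ∧ Function.Injective ν ∧
      (∀ a, ν a < Fintype.card κ) ∧ (∀ a, ∑ j, μ a j < Fintype.card κ) ∧ V ≠ 0 ∧ U ≠ 0 ∧
      (Matrix.of fun a b => hasse ((μ b).cons (ν a)) F).det = inFst n V * inTail U := by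
  classical
  set f : Fin (r 0 + 1) → MvPolynomial (Fin n) ℚ := fun k =>
    (MvPolynomial.finSuccEquiv ℚ n F).coeff k with hf
  obtain ⟨κ, g, hg, hspan, hlin⟩ := exists_linearIndependent' ℚ f
  have : Finite κ := Finite.of_injective g hg
  let _ : Fintype κ := Fintype.ofFinite κ
  set φ : κ → MvPolynomial (Fin n) ℚ := f ∘ g with hφ
  have hmem : ∀ k, ∃ c : κ → ℚ, ∑ l, c l • φ l = f k := fun k => by
    rw [← Submodule.mem_span_range_iff_exists_fun, hspan]
    exact Submodule.subset_span ⟨k, rfl⟩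
  choose A hA using hmem
  set ψ : κ → ℚ[X] := fun l => ∑ k : Fin (r 0 + 1), Polynomial.monomial (k : ℕ) (A k l) with hψ
  have hcoeff : ∀ l (k : Fin (r 0 + 1)), (ψ l).coeff k = A k l := by
    intro l k
    simp [hψ, Polynomial.coeff_monomial, Fin.val_inj]
  have hcoeff_gt : ∀ l (k : ℕ), r 0 < k → (ψ l).coeff k = 0 := by
    intro l k hk
    simp only [hψ, Polynomial.finsetSum_coeff, Polynomial.coeff_monomial]
    refine sum_eq_zero fun i _ => if_neg ?_
    omega
  have hdelta : ∀ l l', A (g l) l' = if l' = l then 1 else 0 := by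
    intro l l'
    have h1 : ∑ m, (A (g l) m - if m = l then 1 else 0) • φ m = 0 := by
      simp only [sub_smul, sum_sub_distrib, hA]
      simp [hφ]
    have := Fintype.linearIndependent_iff.mp hlin _ h1 l'
    linarith
  have hψlin : LinearIndependent ℚ ψ := by
    rw [Fintype.linearIndependent_iff]
    intro c hc l
    have := congrArg (fun q => Polynomial.coeff q (g l : ℕ)) hc
    simpa [Polynomial.finsetSum_coeff, hcoeff, hdelta] using this
  have hFsum : F = ∑ l, inFst n (ψ l) * inTail (φ l) := by
    ext k
    rw [MvPolynomial.coeff_sum]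
    simp only [coeff_inFst_mul_inTail]
    by_cases hk : k 0 ≤ r 0
    · have h1 := congrArg (MvPolynomial.coeff k.tail) (hA ⟨k 0, Nat.lt_succ_of_le hk⟩)
      rw [hf, MvPolynomial.finSuccEquiv_coeff_coeff, Finsupp.cons_tail,
        MvPolynomial.coeff_sum] at h1
      rw [← h1]
      refine sum_congr rfl fun l _ => ?_
      rw [MvPolynomial.coeff_smul, smul_eq_mul, ← hcoeff l ⟨k 0, Nat.lt_succ_of_le hk⟩]
    · rw [sum_eq_zero fun l _ => by rw [hcoeff_gt l _ (not_le.mp hk), zero_mul]]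
      by_contra hne
      exact hk (hr k hne 0)
  obtain ⟨μ, hμ, hU⟩ := exists_det_hasse_ne_zero hlin
  obtain ⟨ν, hνinj, hν, hV⟩ := exists_det_hasseDeriv_ne_zero hψlin
  refine ⟨κ, inferInstance, inferInstance, ν, μ, _, _, ?_, ?_, hνinj, hν, hμ, hV, hU, ?_⟩
  · rw [Fintype.card_pos_iff]
    by_contra hemp
    rw [not_nonempty_iff] at hemp
    exact hF (by rw [hFsum]; simp)
  · simpa using Fintype.card_le_of_injective g hg
  · have hmat : (Matrix.of fun a b => hasse ((μ b).cons (ν a)) F) =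
        ((Matrix.of fun a l => hasseDeriv (ν a) (ψ l)).map (inFst n)) *
          ((Matrix.of fun b l => hasse (μ b) (φ l)).map inTail).transpose := by
      ext1 a b
      rw [Matrix.mul_apply]
      simp only [Matrix.of_apply, Matrix.map_apply, Matrix.transpose_apply]
      have h2 := hasse_sum_mul univ (fun _ => (1 : ℚ)) ((μ b).cons (ν a))
        (fun l => inFst n (ψ l) * inTail (φ l))
      simp only [map_one, one_mul] at h2
      rw [hFsum, h2]
      exact sum_congr rfl fun l _ => hasse_inFst_mul_inTail _ _ _ _
    rw [hmat, Matrix.det_mul, Matrix.det_transpose, AlgHom.map_det, AlgHom.map_det]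
    rfl

end Roth

/-! ### Heights and slices -/

namespace Roth

open Finset

/-- The naive height of a rational number. -/
def ht (β : ℚ) : ℕ := max β.num.natAbs β.den

lemma ht_pos (β : ℚ) : 0 < ht β := lt_max_of_lt_right β.den_pos

/-- A polynomial with integer coefficients vanishing to high order at a rational number of large
height has a large coefficient. -/
lemma exists_ht_pow_le {W : ℤ[X]} (hW : W ≠ 0) {β : ℚ} {e : ℕ}
    (h : ∀ i < e, (taylor β (W.map (Int.castRingHom ℚ))).coeff i = 0) :
    ∃ k, ht β ^ e ≤ (W.coeff k).natAbs := by
  have h1 : (X - C β) ^ e ∣ W.map (Int.castRingHom ℚ) := by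
    obtain ⟨Q, hQ⟩ := X_pow_dvd_iff.mpr h
    refine ⟨taylor (-β) Q, ?_⟩
    have := congrArg (taylor (-β)) hQ
    rw [taylor_taylor, neg_add_cancel, taylor_zero, taylor_mul, taylor_pow, taylor_X] at this
    rw [this, C_neg, sub_eq_add_neg]
  obtain ⟨L, hL⟩ : ∃ L : ℤ[X], L = C (β.den : ℤ) * X + C (-β.num) := ⟨_, rfl⟩
  have hden : (β.den : ℤ) ≠ 0 := by exact_mod_cast β.den_ne_zero
  have hprim : L.IsPrimitive := by
    rw [isPrimitive_iff_isUnit_of_C_dvd]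
    intro r hr
    rw [C_dvd_iff_dvd_coeff] at hr
    have hr0 : r ∣ β.num := by simpa [hL] using hr 0
    have hr1 : r ∣ (β.den : ℤ) := by
      have := hr 1
      rwa [hL, coeff_add, coeff_C_mul, coeff_X_one, coeff_C_of_ne_zero one_ne_zero, mul_one,
        add_zero] at this
    have hcop : IsCoprime β.num (β.den : ℤ) := Int.isCoprime_iff_gcd_eq_one.mpr β.reduced
    exact hcop.isUnit_of_dvd' hr0 hr1
  have hpow : (L ^ e).IsPrimitive := by
    induction e with
    | zero => simp
    | succ e ih =>
      rw [pow_succ]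
      exact (ih (fun i hi => h i (by omega)) ((pow_dvd_pow _ (Nat.le_succ e)).trans h1)).mul hprim
  have h2 : L ^ e ∣ W := by
    refine (IsPrimitive.Int.dvd_iff_map_cast_dvd_map_cast _ _ hpow).mpr ?_
    have hmap : L.map (Int.castRingHom ℚ) = C (β.den : ℚ) * (X - C β) := by
      rw [hL, mul_sub, ← C_mul, mul_comm (β.den : ℚ) β, Rat.mul_den_eq_num]
      simp [sub_eq_add_neg]
    rw [Polynomial.map_pow, hmap, mul_pow, ← C_pow]
    exact (isUnit_C.mpr (by simp)).mul_left_dvd.mpr h1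
  obtain ⟨G, hG⟩ := h2
  have hG0 : G ≠ 0 := by
    rintro rfl
    simp [hG] at hW
  have hlead : L.leadingCoeff = β.den := by
    rw [hL, leadingCoeff_linear hden]
  rcases le_total β.num.natAbs β.den with hle | hle
  · refine ⟨W.natDegree, ?_⟩
    have : W.coeff W.natDegree = (β.den : ℤ) ^ e * G.leadingCoeff := by
      rw [← leadingCoeff, hG, leadingCoeff_mul, leadingCoeff_pow, hlead]
    rw [this, Int.natAbs_mul, Int.natAbs_pow, Int.natAbs_natCast, ht, max_eq_right hle]
    exact Nat.le_mul_of_pos_right _ (Int.natAbs_pos.mpr (leadingCoeff_ne_zero.mpr hG0))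
  · have hnum : β.num ≠ 0 := by
      intro h0
      have := β.den_pos
      simp [h0] at hle
    have htrail : L.trailingCoeff = -β.num := by
      have : L.natTrailingDegree = 0 := by
        rw [natTrailingDegree_eq_zero]
        exact Or.inr (by simpa [hL] using hnum)
      rw [trailingCoeff, this]
      simp [hL]
    refine ⟨W.natTrailingDegree, ?_⟩
    have hpowtrail : (L ^ e).trailingCoeff = L.trailingCoeff ^ e := by
      clear hpow hG h h1
      induction e with
      | zero => simp [trailingCoeff]
      | succ e ih => rw [pow_succ, trailingCoeff_mul, ih, pow_succ]
    have : W.coeff W.natTrailingDegree = (-β.num) ^ e * G.trailingCoeff := by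
      rw [← trailingCoeff, hG, trailingCoeff_mul, hpowtrail, htrail]
    rw [this, Int.natAbs_mul, Int.natAbs_pow, Int.natAbs_neg, ht, max_eq_left hle]
    exact Nat.le_mul_of_pos_right _ (Int.natAbs_pos.mpr (trailingCoeff_nonzero_iff_nonzero.mpr hG0))

/-- The coefficient of `X₀ ^ k`, as a polynomial in the other variables. -/
noncomputable def slice {R : Type*} [CommRing R] {n : ℕ} (k : ℕ)
    (P : MvPolynomial (Fin (n + 1)) R) : MvPolynomial (Fin n) R :=
  (MvPolynomial.finSuccEquiv R n P).coeff k

lemma coeff_slice {R : Type*} [CommRing R] {n : ℕ} (k : ℕ) (P : MvPolynomial (Fin (n + 1)) R)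
    (m : Fin n →₀ ℕ) : (slice k P).coeff m = P.coeff (m.cons k) :=
  MvPolynomial.finSuccEquiv_coeff_coeff m P k

lemma len_slice_le {n : ℕ} (k : ℕ) (P : MvPolynomial (Fin (n + 1)) ℤ) :
    len (slice k P) ≤ len P := by
  classical
  unfold len
  simp only [coeff_slice]
  have hinj : Function.Injective fun m : Fin n →₀ ℕ => m.cons k := fun m m' h => by
    simpa using congrArg Finsupp.tail h
  rw [← sum_image (f := fun m => (P.coeff m).natAbs) (g := fun m : Fin n →₀ ℕ => m.cons k)
    hinj.injOn]
  refine sum_le_sum_of_subset fun m hm => ?_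
  obtain ⟨m, hm', rfl⟩ := mem_image.mp hm
  rw [MvPolynomial.mem_support_iff, coeff_slice] at hm'
  exact MvPolynomial.mem_support_iff.mpr hm'

/-- The coefficient of `X^i'` in the last variables, as a polynomial in the first one. -/
noncomputable def fiber {R : Type*} [CommRing R] {n : ℕ} (i : Fin n →₀ ℕ) (d : ℕ)
    (P : MvPolynomial (Fin (n + 1)) R) : R[X] :=
  ∑ k ∈ range (d + 1), Polynomial.monomial k (P.coeff (i.cons k))

lemma coeff_fiber {R : Type*} [CommRing R] {n : ℕ} {P : MvPolynomial (Fin (n + 1)) R}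
    {r : Fin (n + 1) → ℕ} (hr : Box r P) (i : Fin n →₀ ℕ) (k : ℕ) :
    (fiber i (r 0) P).coeff k = P.coeff (i.cons k) := by
  simp only [fiber, finsetSum_coeff, coeff_monomial, sum_ite_eq', mem_range]
  split_ifs with h
  · rfl
  · by_contra hne
    have := hr _ (Ne.symm hne) 0
    rw [Finsupp.cons_zero] at this
    omega

lemma sum_max_ge {κ : Type*} [Fintype κ] {ν : κ → ℕ} (hinj : Function.Injective ν)
    (hν : ∀ a, ν a < Fintype.card κ) {r : ℕ} (hr : 0 < r) (hcard : Fintype.card κ ≤ r + 1)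
    {θ : ℝ} (hθ : 0 < θ) (hθ1 : θ ≤ 1) :
    Fintype.card κ * θ ^ 2 / 8 ≤ ∑ a, max 0 (θ - (ν a : ℝ) / r) := by
  classical
  set t := Fintype.card κ with ht
  have himg : univ.image ν = range t := by
    apply eq_of_subset_of_card_le
    · intro x hx
      obtain ⟨a, -, rfl⟩ := mem_image.mp hx
      exact mem_range.mpr (hν a)
    · rw [card_image_of_injective _ hinj, card_range, card_univ]
  have hsum : ∑ a, max 0 (θ - (ν a : ℝ) / r) = ∑ i ∈ range t, max 0 (θ - (i : ℝ) / r) := by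
    rw [← himg, sum_image hinj.injOn]
  rw [hsum]
  have hr' : (0 : ℝ) < r := by exact_mod_cast hr
  set N := min t (⌊θ * r / 2⌋₊ + 1) with hN
  have h1 : (N : ℝ) * (θ / 2) ≤ ∑ i ∈ range t, max 0 (θ - (i : ℝ) / r) := by
    calc (N : ℝ) * (θ / 2) = ∑ i ∈ range N, θ / 2 := by simp
      _ ≤ ∑ i ∈ range N, max 0 (θ - (i : ℝ) / r) := by
        refine sum_le_sum fun i hi => le_max_of_le_right ?_
        have hi' : i ≤ ⌊θ * r / 2⌋₊ := by
          have := mem_range.mp hi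
          omega
        have := (Nat.le_floor_iff (by positivity)).mp hi'
        rw [le_sub_comm, div_le_iff₀ hr']
        linarith
      _ ≤ _ := sum_le_sum_of_subset_of_nonneg (range_subset_range.mpr (min_le_left _ _))
        fun _ _ _ => le_max_left _ _
  have h2 : (t : ℝ) * θ / 4 ≤ N := by
    have ht2 : (t : ℝ) ≤ 2 * r := by
      have : t ≤ 2 * r := by omega
      exact_mod_cast this
    rw [hN, Nat.cast_min, le_min_iff]
    constructor
    · nlinarith [Nat.cast_nonneg (α := ℝ) t]
    · have := Nat.lt_floor_add_one (θ * r / 2)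
      push_cast
      nlinarith
  nlinarith

end Roth

/-! ### Roth's lemma -/

namespace Roth

open Finset

/-- Roth's lemma in `n` variables with parameters `θ` and `ω`: a nonzero integer polynomial of
multidegree at most `r`, where `r` increases rapidly, with small coefficients, has index less than
`θ` at a rational point whose coordinates have large heights. -/
def IndexBound (n : ℕ) (θ ω : ℝ) : Prop :=
  ∀ (r : Fin n → ℕ) (β : Fin n → ℚ) (L : ℝ) (P : MvPolynomial (Fin n) ℤ), P ≠ 0 → Box r P →
    (∀ j, 0 < r j) → (∀ i j, i < j → (r i : ℝ) ≤ ω * r j) →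
    (∀ j, L ≤ r j * Real.log (ht (β j))) → (∀ j, (r j : ℝ) ≤ ω * L) →
    Real.log (len P) ≤ ω * L →
    ¬ Ord (fun j => (r j : ℝ)⁻¹) θ (shift β (P.map (Int.castRingHom ℚ)))

lemma log_len_det_le {σ κ : Type*} [Fintype κ] [DecidableEq κ] [Nonempty κ]
    (M : Matrix κ κ (MvPolynomial σ ℤ)) (hM : M.det ≠ 0) {d S ℓ : ℕ} (hd : Fintype.card κ ≤ d + 1)
    (hℓ : 0 < ℓ) (hB : ∀ a b, len (M a b) ≤ 2 ^ S * ℓ) :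
    Real.log (len M.det) ≤ Fintype.card κ * (d + S + Real.log ℓ) := by
  set t := Fintype.card κ with ht
  have ht0 : 0 < t := Fintype.card_pos
  have h1 : len M.det ≤ (t * (2 ^ S * ℓ)) ^ t := by
    rw [mul_pow]
    exact (len_det_le M hB).trans (Nat.mul_le_mul_right _ (Nat.factorial_le_pow t))
  have h2 : (0 : ℝ) < len M.det := by exact_mod_cast one_le_len hM
  have h3 : (len M.det : ℝ) ≤ ((t : ℝ) * (2 ^ S * ℓ)) ^ t := by exact_mod_cast h1
  have ht0' : (0 : ℝ) < t := by exact_mod_cast ht0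
  have hℓ' : (0 : ℝ) < ℓ := by exact_mod_cast hℓ
  have h4 := Real.log_le_log h2 h3
  rw [Real.log_pow, Real.log_mul ht0'.ne' (by positivity), Real.log_mul (by positivity) hℓ'.ne',
    Real.log_pow] at h4
  refine h4.trans (mul_le_mul_of_nonneg_left ?_ ht0'.le)
  have h5 : Real.log t ≤ d := by
    have := Real.log_le_sub_one_of_pos ht0'
    have hd' : (t : ℝ) ≤ d + 1 := by exact_mod_cast hd
    linarith
  have h6 : (S : ℝ) * Real.log 2 ≤ S :=
    mul_le_of_le_one_right (Nat.cast_nonneg S) (by linarith [Real.log_two_lt_d9])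
  linarith

lemma sum_inv_mul_le {n : ℕ} {r : Fin (n + 1) → ℕ} (hr : ∀ j, 0 < r j) {ω : ℝ}
    (hω : 0 ≤ ω) (h : ∀ i j, i < j → (r i : ℝ) ≤ ω * r j) {μ : Fin n →₀ ℕ} (hμ : ∑ j, μ j ≤ r 0) :
    ∑ j : Fin n, (r j.succ : ℝ)⁻¹ * μ j ≤ ω := by
  have h0 : (0 : ℝ) < r 0 := by exact_mod_cast hr 0
  have h1 : ∀ j : Fin n, (r j.succ : ℝ)⁻¹ * μ j ≤ ω / r 0 * μ j := fun j => by
    refine mul_le_mul_of_nonneg_right ?_ (Nat.cast_nonneg _)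
    have hj : (0 : ℝ) < r j.succ := by exact_mod_cast hr j.succ
    rw [le_div_iff₀ h0, inv_mul_le_iff₀ hj, mul_comm]
    exact h 0 j.succ (Fin.succ_pos j)
  refine (sum_le_sum fun j _ => h1 j).trans ?_
  rw [← mul_sum]
  have h2 : (∑ j, (μ j : ℝ)) ≤ r 0 := by exact_mod_cast hμ
  calc ω / r 0 * ∑ j, (μ j : ℝ) ≤ ω / r 0 * r 0 := by gcongr
    _ = ω := by field_simp

lemma indexBound_succ {n : ℕ} {θ ω₁ : ℝ} (hθ : 0 < θ) (hθ1 : θ ≤ 1) (hω₁ : 0 < ω₁)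
    (ih : IndexBound n (θ ^ 2 / 64) ω₁) : ∃ ω, 0 < ω ∧ IndexBound (n + 1) θ ω := by
  obtain ⟨ω, hω, hω2, hωω₁, hωθ⟩ : ∃ ω : ℝ, 0 < ω ∧ ω ≤ θ / 2 ∧ (n + 4) * ω ≤ ω₁ ∧
      (n + 4) * ω ≤ θ ^ 2 / 64 := by
    refine ⟨min (θ / 2) (min (ω₁ / (n + 4)) (θ ^ 2 / 64 / (n + 4))), by positivity,
      min_le_left _ _, ?_, ?_⟩ <;> rw [mul_comm, ← le_div_iff₀ (by positivity)]
    · exact (min_le_right _ _).trans (min_le_left _ _)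
    · exact (min_le_right _ _).trans (min_le_right _ _)
  have hn : (0 : ℝ) ≤ n := Nat.cast_nonneg n
  have hωle : ω ≤ ω₁ := by nlinarith
  have hω₃ : (n + 3) * ω ≤ ω₁ := by linarith
  have hωθ₃ : (n + 3) * ω < θ ^ 2 / 64 := by linarith
  refine ⟨ω, hω, ?_⟩
  intro r β L P hP hbox hr hinc hL hrL hlen hord
  have hr0 : (0 : ℝ) < r 0 := by exact_mod_cast hr 0
  have hL0 : 0 < L := by
    have := hr0.trans_le (hrL 0)
    exact pos_of_mul_pos_right this hω.le
  set F := P.map (Int.castRingHom ℚ) with hFdef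
  have hF : F ≠ 0 := (MvPolynomial.map_injective _ Int.cast_injective).ne_iff' (map_zero _) |>.mpr
      hP
  have hboxF : Box r F := fun k hk => hbox k fun h => hk (by
    simp [hFdef, MvPolynomial.coeff_map, h])
  obtain ⟨κ, _, _, ν, μ, V, U, ht0, htr, hνinj, hν, hμ, hV, hU, hdet⟩ :=
    exists_det_hasse_eq_mul hF hboxF
  set t := Fintype.card κ 
  have : Nonempty κ := Fintype.card_pos_iff.mp ht0
  have ht0' : (0 : ℝ) < t := by exact_mod_cast ht0
  set M : Matrix κ κ (MvPolynomial (Fin (n + 1)) ℤ) :=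
    Matrix.of fun a b => hasse ((μ b).cons (ν a)) P with hM
  have hmapM : M.det.map (Int.castRingHom ℚ) = inFst n V * inTail U := by
    rw [← hdet, RingHom.map_det]
    congr 1
    ext1 a b
    exact map_hasse _ _ _
  have hcoeff : ∀ k, ((M.det.coeff k : ℤ) : ℚ) = V.coeff (k 0) * U.coeff k.tail := fun k => by
    rw [← coeff_inFst_mul_inTail, ← hmapM, MvPolynomial.coeff_map]
    rfl
  obtain ⟨i₁, hi₁⟩ := MvPolynomial.ne_zero_iff.mp hU
  obtain ⟨k₁, hk₁⟩ : ∃ k, V.coeff k ≠ 0 := by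
    by_contra! h
    exact hV (Polynomial.ext h)
  have hM0 : M.det ≠ 0 := by
    intro h
    have := hcoeff (i₁.cons k₁)
    simp [h, hk₁, hi₁] at this
  have hMbox : Box (fun j => t * r j) M.det := Box.det fun a b => hbox.hasse _
  have hlenM : Real.log (len M.det) ≤ t * ((n + 3) * ω * L) := by
    refine (log_len_det_le M hM0 htr (one_le_len hP) fun a b => len_hasse_le hbox _).trans
      (mul_le_mul_of_nonneg_left ?_ ht0'.le)
    have h1 : ((∑ j, r j : ℕ) : ℝ) ≤ (n + 1) * (ω * L) := by
      push_cast
      exact (sum_le_card_nsmul _ _ _ fun j _ => hrL j).trans (by simp)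
    linarith [hrL 0]
  set θ₁ := θ ^ 2 / 64 with hθ₁
  have hlenM' : Real.log (len M.det) < t * θ₁ * L := by
    refine hlenM.trans_lt ?_
    rw [mul_assoc (t : ℝ)]
    exact mul_lt_mul_of_pos_left (mul_lt_mul_of_pos_right hωθ₃ hL0) ht0'
  obtain ⟨i₀, hi₀, hVi₀⟩ : ∃ i₀ : ℕ, (i₀ : ℝ) < t * θ₁ * r 0 ∧ (taylor (β 0) V).coeff i₀ ≠ 0 := by
    by_contra! hvan
    set W := fiber i₁ (t * r 0) M.det with hW
    have hWcoeff : ∀ k, W.coeff k = M.det.coeff (i₁.cons k) := coeff_fiber hMbox i₁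
    have hWmap : W.map (Int.castRingHom ℚ) = C (U.coeff i₁) * V := by
      ext k
      rw [coeff_map, hWcoeff, coeff_C_mul, eq_intCast, hcoeff]
      simp [mul_comm]
    have hW0 : W ≠ 0 := by
      intro h
      have := congrArg (fun q => q.coeff k₁) hWmap
      simp [h, hi₁, hk₁] at this
    obtain ⟨k, hk⟩ := exists_ht_pow_le hW0 (β := β 0) (e := ⌈t * θ₁ * r 0⌉₊) fun i hi => by
      rw [hWmap, taylor_mul, taylor_C, coeff_C_mul, hvan i (Nat.lt_ceil.mp hi), mul_zero]
    rw [hWcoeff] at hk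
    have h2 : ((ht (β 0) : ℝ)) ^ ⌈t * θ₁ * r 0⌉₊ ≤ len M.det := by
      exact_mod_cast hk.trans (natAbs_coeff_le_len _ _)
    have hht : (0 : ℝ) < ht (β 0) := by exact_mod_cast ht_pos _
    have h3 := Real.log_le_log (by positivity) h2
    rw [Real.log_pow] at h3
    have h4 : t * θ₁ * r 0 * Real.log (ht (β 0)) ≤ ⌈t * θ₁ * r 0⌉₊ * Real.log (ht (β 0)) :=
      mul_le_mul_of_nonneg_right (Nat.le_ceil _)
        (Real.log_nonneg (by exact_mod_cast ht_pos (β 0)))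
    have h5 : t * θ₁ * L ≤ t * θ₁ * (r 0 * Real.log (ht (β 0))) :=
      mul_le_mul_of_nonneg_left (hL 0) (by positivity)
    linarith
  obtain ⟨i', hi', hUi'⟩ : ∃ i' : Fin n →₀ ℕ, ∑ j : Fin n, (r j.succ : ℝ)⁻¹ * i' j < t * θ₁ ∧
      (shift (fun j => β j.succ) U).coeff i' ≠ 0 := by
    have hS0 : slice k₁ M.det ≠ 0 := by
      intro h
      have h1 := coeff_slice k₁ M.det i₁
      have h2 := hcoeff (i₁.cons k₁)
      rw [← h1, h] at h2
      simp [hi₁, hk₁] at h2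
    have hSmap : (slice k₁ M.det).map (Int.castRingHom ℚ) = MvPolynomial.C (V.coeff k₁) * U := by
      ext k
      rw [MvPolynomial.coeff_map, coeff_slice, MvPolynomial.coeff_C_mul, eq_intCast, hcoeff]
      simp
    have hnot := ih (fun j => t * r j.succ) (fun j => β j.succ) (t * L) (slice k₁ M.det) hS0
      (fun k hk j => by
        rw [coeff_slice] at hk
        simpa using hMbox _ hk j.succ)
      (fun j => Nat.mul_pos ht0 (hr _))
      (fun i j hij => by
        have := hinc i.succ j.succ (Fin.succ_lt_succ_iff.mpr hij)
        have hj : (0 : ℝ) ≤ r j.succ := Nat.cast_nonneg _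
        push_cast
        rw [mul_left_comm]
        exact mul_le_mul_of_nonneg_left (this.trans (mul_le_mul_of_nonneg_right hωle hj)) ht0'.le)
      (fun j => by
        push_cast
        rw [mul_assoc]
        exact mul_le_mul_of_nonneg_left (hL _) ht0'.le)
      (fun j => by
        push_cast
        rw [mul_left_comm]
        exact mul_le_mul_of_nonneg_left
          ((hrL j.succ).trans (mul_le_mul_of_nonneg_right hωle hL0.le)) ht0'.le)
      (by
        have h1 : Real.log (len (slice k₁ M.det)) ≤ Real.log (len M.det) :=
          Real.log_le_log (by exact_mod_cast one_le_len hS0) (by exact_mod_cast len_slice_le _ _)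
        rw [mul_left_comm]
        exact h1.trans (hlenM.trans (mul_le_mul_of_nonneg_left
          (mul_le_mul_of_nonneg_right hω₃ hL0.le) ht0'.le)))
    rw [hSmap] at hnot
    unfold Ord at hnot
    push Not at hnot
    obtain ⟨i', hne, hlt⟩ := hnot
    refine ⟨i', ?_, ?_⟩
    · have : ∑ j : Fin n, (r j.succ : ℝ)⁻¹ * i' j =
          t * ∑ j : Fin n, ((t * r j.succ : ℕ) : ℝ)⁻¹ * i' j := by
        rw [mul_sum]
        refine sum_congr rfl fun j _ => ?_
        push_cast
        rw [mul_inv, ← mul_assoc, ← mul_assoc, mul_inv_cancel₀ ht0'.ne', one_mul]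
      rw [this]
      exact mul_lt_mul_of_pos_left hlt ht0'
    · intro h
      apply hne
      rw [map_mul, ← MvPolynomial.algebraMap_eq, AlgHom.commutes, MvPolynomial.algebraMap_eq,
        MvPolynomial.coeff_C_mul, h, mul_zero]
  set w : Fin (n + 1) → ℝ := fun j => (r j : ℝ)⁻¹ with hw
  have hordM : Ord w (∑ a, max 0 (θ / 2 - (ν a : ℝ) / r 0)) (inFst n (taylor (β 0) V) *
      inTail (shift (fun j => β j.succ) U)) := by
    have h1 : inFst n (taylor (β 0) V) * inTail (shift (fun j => β j.succ) U) =
        ((Matrix.of fun a b => hasse ((μ b).cons (ν a)) F).map (shift β)).det := by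
      rw [← shift_inFst, ← shift_inTail, ← map_mul, ← hdet, AlgHom.map_det]
      rfl
    rw [h1]
    refine Ord.det fun a b k hk => max_le ?_ ?_
    · exact sum_nonneg fun j _ => by positivity
    · refine le_trans ?_ (hord.shift_hasse _ k hk)
      rw [Fin.sum_univ_succ]
      simp only [Finsupp.cons_zero, Finsupp.cons_succ]
      have h2 := sum_inv_mul_le hr hω.le hinc (μ := μ b) (by have := hμ b; omega)
      have h3 : (r 0 : ℝ)⁻¹ * ν a = ν a / r 0 := by rw [div_eq_inv_mul]
      simp only [hw]
      linarith
  have hsum := sum_max_ge hνinj hν (hr 0) htr (half_pos hθ) (by linarith)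
  have hfin := hordM (i'.cons i₀) (by
    rw [coeff_inFst_mul_inTail]
    simpa using ⟨hVi₀, hUi'⟩)
  rw [Fin.sum_univ_succ] at hfin
  simp only [Finsupp.cons_zero, Finsupp.cons_succ, hw] at hfin
  have h6 : (r 0 : ℝ)⁻¹ * i₀ < t * θ₁ := by
    rw [inv_mul_lt_iff₀ hr0]
    linarith
  have h7 : (t : ℝ) * (θ / 2) ^ 2 / 8 = 2 * (t * θ₁) := by rw [hθ₁]; ring
  linarith

/-- Roth's lemma. -/
lemma exists_indexBound (n : ℕ) : ∀ {θ : ℝ}, 0 < θ → ∃ ω, 0 < ω ∧ IndexBound n θ ω := by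
  induction n with
  | zero =>
    intro θ hθ
    refine ⟨1, one_pos, fun r β L P hP _ _ _ _ _ _ hord => ?_⟩
    have hF : P.map (Int.castRingHom ℚ) ≠ 0 :=
      (MvPolynomial.map_injective _ Int.cast_injective).ne_iff' (map_zero _) |>.mpr
      hP
    obtain ⟨k, hk⟩ := MvPolynomial.ne_zero_iff.mp (shift_ne_zero β hF)
    have := hord k hk
    simp at this
    linarith
  | succ n ih =>
    intro θ hθ
    have hθ' : 0 < min θ 1 := lt_min hθ one_pos
    obtain ⟨ω₁, hω₁, h₁⟩ := ih (θ := min θ 1 ^ 2 / 64) (by positivity)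
    obtain ⟨ω, hω, h⟩ := indexBound_succ hθ' (min_le_right _ _) hω₁ h₁
    exact ⟨ω, hω, fun r β L P h0 h1 h2 h3 h4 h5 h6 hord =>
      h r β L P h0 h1 h2 h3 h4 h5 h6 (hord.mono (min_le_left _ _))⟩

end Roth

/-! ### Siegel's lemma and the counting of exponents -/

namespace Roth

open Finset

section Siegel

attribute [local instance] Matrix.seminormedAddCommGroup

/-- Siegel's lemma with at least twice as many unknowns as equations. -/
lemma exists_mulVec_eq_zero {E B : Type*} [Fintype E] [Fintype B] (A : Matrix E B ℤ) {D : ℕ}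
    (hD : 1 ≤ D) (hA : ∀ i j, (A i j).natAbs ≤ D) (hE : 0 < Fintype.card E)
    (hEB : 2 * Fintype.card E ≤ Fintype.card B) :
    ∃ c : B → ℤ, c ≠ 0 ∧ A.mulVec c = 0 ∧ ∀ j, (c j).natAbs ≤ Fintype.card B * D := by
  obtain ⟨c, hc, hAc, hbound⟩ := Int.Matrix.exists_ne_zero_int_vec_norm_le A (by omega) hE
  refine ⟨c, hc, hAc, fun j => ?_⟩
  have hnat : ∀ x : ℤ, ‖x‖ = (x.natAbs : ℝ) := fun x => by
    rw [Int.norm_eq_abs, Nat.cast_natAbs, Int.cast_abs]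
  have hE' : (0 : ℝ) < Fintype.card E := by exact_mod_cast hE
  have hEB' : 2 * (Fintype.card E : ℝ) ≤ Fintype.card B := by exact_mod_cast hEB
  have hD' : (1 : ℝ) ≤ D := by exact_mod_cast hD
  have hnorm : max 1 ‖A‖ ≤ D := by
    refine max_le hD' ((Matrix.norm_le_iff (by positivity)).mpr fun i k => ?_)
    rw [hnat]
    exact_mod_cast hA i k
  have h1 : (1 : ℝ) ≤ Fintype.card B * max 1 ‖A‖ := by
    have : (1 : ℝ) ≤ Fintype.card B := by exact_mod_cast (by omega : 1 ≤ Fintype.card B)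
    exact one_le_mul_of_one_le_of_one_le this (le_max_left _ _)
  have h2 : (Fintype.card E : ℝ) / (Fintype.card B - Fintype.card E) ≤ 1 := by
    rw [div_le_one (by linarith)]
    linarith
  have h3 : ‖c j‖ ≤ Fintype.card B * D :=
    calc ‖c j‖ ≤ ‖c‖ := norm_le_pi_norm c j
      _ ≤ _ := hbound
      _ ≤ Fintype.card B * max 1 ‖A‖ := Real.rpow_le_self_of_one_le h1 h2
      _ ≤ _ := by gcongr
  rw [hnat] at h3
  exact_mod_cast h3

end Siegel

section Counting

lemma sum_exp_le (r : ℕ) (hr : 0 < r) (t : ℝ) :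
    ∑ k : Fin (r + 1), Real.exp (t * (1 / 2 - (k : ℝ) / r)) ≤ (r + 1) * Real.exp (t ^ 2 / 8) := by
  have hr' : (0 : ℝ) < r := by exact_mod_cast hr
  have hsymm : ∑ k : Fin (r + 1), Real.exp (t * (1 / 2 - (k : ℝ) / r)) =
      ∑ k : Fin (r + 1), Real.exp (-(t * (1 / 2 - (k : ℝ) / r))) := by
    rw [← Equiv.sum_comp Fin.revPerm]
    refine sum_congr rfl fun k _ => ?_
    congr 1
    have : ((Fin.revPerm k : Fin (r + 1)) : ℝ) = r - k := by
      simp only [Fin.revPerm_apply, Fin.val_rev]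
      rw [Nat.cast_sub (by omega)]
      push_cast
      ring
    rw [this]
    field_simp
    ring
  have hcosh : ∑ k : Fin (r + 1), Real.exp (t * (1 / 2 - (k : ℝ) / r)) =
      ∑ k : Fin (r + 1), Real.cosh (t * (1 / 2 - (k : ℝ) / r)) := by
    simp only [Real.cosh_eq, ← sum_div, sum_add_distrib, ← hsymm]
    ring
  rw [hcosh]
  refine (sum_le_card_nsmul univ _ (Real.exp (t ^ 2 / 8)) fun k _ => ?_).trans (by simp)
  refine (Real.cosh_le_exp_half_sq _).trans (Real.exp_le_exp.mpr ?_)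
  have h1 : (k : ℝ) / r ≤ 1 := by
    rw [div_le_one hr']
    exact_mod_cast Nat.lt_succ_iff.mp k.2
  have h0 : 0 ≤ (k : ℝ) / r := by positivity
  have h2 : (1 / 2 - (k : ℝ) / r) ^ 2 ≤ 1 / 4 := by nlinarith
  nlinarith [mul_le_mul_of_nonneg_left h2 (sq_nonneg t)]

/-- Few points of a box have small weight. -/
lemma card_weight_lt_le {m : ℕ} (r : Fin m → ℕ) (hr : ∀ j, 0 < r j) {ε : ℝ} (hε : 0 < ε) :
    (#{i : (j : Fin m) → Fin (r j + 1) | ∑ j, (r j : ℝ)⁻¹ * (i j : ℕ) < m * (1 / 2 - ε)} : ℝ) ≤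
      (∏ j, ((r j : ℝ) + 1)) * Real.exp (-(2 * ε ^ 2 * m)) := by
  set t := 4 * ε with ht
  have h1 : ∀ i : (j : Fin m) → Fin (r j + 1),
      i ∈ ({i | ∑ j, (r j : ℝ)⁻¹ * (i j : ℕ) < m * (1 / 2 - ε)} : Finset _) →
      (1 : ℝ) ≤ Real.exp (-(t * ε * m)) * ∏ j, Real.exp (t * (1 / 2 - ((i j : ℕ) : ℝ) / r j)) := by
    intro i hi
    rw [← Real.exp_sum, ← Real.exp_add, Real.one_le_exp_iff]
    have := (mem_filter.mp hi).2
    have h2 : ∑ j, t * (1 / 2 - ((i j : ℕ) : ℝ) / r j) =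
        t * (m / 2 - ∑ j, (r j : ℝ)⁻¹ * (i j : ℕ)) := by
      rw [← mul_sum, sum_sub_distrib]
      simp [div_eq_inv_mul, mul_comm]
    rw [h2]
    have h3 : 0 < t := by positivity
    nlinarith
  calc (#{i : (j : Fin m) → Fin (r j + 1) | ∑ j, (r j : ℝ)⁻¹ * (i j : ℕ) < m * (1 / 2 - ε)} : ℝ)
      = ∑ i ∈ ({i | ∑ j, (r j : ℝ)⁻¹ * (i j : ℕ) < m * (1 / 2 - ε)} :
          Finset ((j : Fin m) → Fin (r j + 1))), (1 : ℝ) := by simp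
    _ ≤ ∑ i ∈ ({i | ∑ j, (r j : ℝ)⁻¹ * (i j : ℕ) < m * (1 / 2 - ε)} :
          Finset ((j : Fin m) → Fin (r j + 1))),
          Real.exp (-(t * ε * m)) * ∏ j, Real.exp (t * (1 / 2 - ((i j : ℕ) : ℝ) / r j)) :=
        sum_le_sum h1
    _ ≤ ∑ i : (j : Fin m) → Fin (r j + 1),
          Real.exp (-(t * ε * m)) * ∏ j, Real.exp (t * (1 / 2 - ((i j : ℕ) : ℝ) / r j)) :=
        sum_le_sum_of_subset_of_nonneg (subset_univ _) fun _ _ _ => by positivity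
    _ = Real.exp (-(t * ε * m)) *
          ∏ j, ∑ k : Fin (r j + 1), Real.exp (t * (1 / 2 - ((k : ℕ) : ℝ) / r j)) := by
        rw [← mul_sum, Fintype.prod_sum]
    _ ≤ Real.exp (-(t * ε * m)) * ∏ j, (((r j : ℝ) + 1) * Real.exp (t ^ 2 / 8)) := by
        refine mul_le_mul_of_nonneg_left (prod_le_prod (fun j _ => by positivity)
          fun j _ => sum_exp_le (r j) (hr j) t) (by positivity)
    _ = _ := by
        rw [prod_mul_distrib, prod_const, ← Real.exp_nat_mul, card_univ, Fintype.card_fin,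
          mul_left_comm, ← Real.exp_add]
        congr 2
        rw [ht]
        ring

end Counting

section Powers

/-- The powers of an integral element are integer combinations of `1, …, α ^ (d - 1)` with at most
exponentially growing coefficients. -/
lemma exists_pow_eq_aeval {K : Type*} [Field K] {α : K} (hα : IsIntegral ℤ α) :
    ∃ d C : ℕ, 0 < d ∧ 1 ≤ C ∧ ∀ e : ℕ, ∃ q : ℤ[X], (∀ k, d ≤ k → q.coeff k = 0) ∧
      (∀ k, (q.coeff k).natAbs ≤ C ^ e) ∧ aeval α q = α ^ e := by
  obtain ⟨f, hf, hfα⟩ := hα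
  rw [← aeval_def] at hfα
  have hd : 0 < f.natDegree := by
    rw [Nat.pos_iff_ne_zero]
    intro h
    rw [hf.natDegree_eq_zero.mp h] at hfα
    simp at hfα
  refine ⟨f.natDegree, 1 + ∑ k ∈ range (f.natDegree + 1), (f.coeff k).natAbs, hd,
    Nat.le_add_right _ _, fun e => ?_⟩
  set C := 1 + ∑ k ∈ range (f.natDegree + 1), (f.coeff k).natAbs with hC
  induction e with
  | zero =>
    refine ⟨1, fun k hk => coeff_one.trans (if_neg (by omega)), fun k => ?_, by simp⟩
    rw [coeff_one]
    split_ifs <;> simp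
  | succ e ih =>
    obtain ⟨q, h0, hb, hq⟩ := ih
    have hcoeff : ∀ k, (f.coeff k).natAbs + 1 ≤ C := fun k => by
      by_cases hk : k ∈ range (f.natDegree + 1)
      · have := single_le_sum (f := fun k => (f.coeff k).natAbs) (fun _ _ => Nat.zero_le _) hk
        omega
      · rw [mem_range, not_lt] at hk
        rw [coeff_eq_zero_of_natDegree_lt (by omega)]
        simp [hC]
    refine ⟨X * q - Polynomial.C (q.coeff (f.natDegree - 1)) * f, fun k hk => ?_, fun k => ?_, ?_⟩
    · obtain ⟨k, rfl⟩ : ∃ l, k = l + 1 := ⟨k - 1, by omega⟩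
      rw [coeff_sub, coeff_X_mul, coeff_C_mul]
      rcases hk.eq_or_lt with hk | hk
      · rw [← hk, hf.coeff_natDegree, mul_one, hk, Nat.add_sub_cancel, sub_self]
      · rw [h0 k (by omega), coeff_eq_zero_of_natDegree_lt hk]
        simp
    · have h1 : (q.coeff (f.natDegree - 1) * f.coeff k).natAbs ≤ C ^ e * (f.coeff k).natAbs := by
        rw [Int.natAbs_mul]
        exact Nat.mul_le_mul_right _ (hb _)
      have h2 : ((X * q).coeff k).natAbs ≤ C ^ e := by
        rcases k with _ | k
        · simp
        · rw [coeff_X_mul]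
          exact hb k
      rw [coeff_sub, coeff_C_mul, pow_succ]
      calc _ ≤ _ := Int.natAbs_sub_le _ _
        _ ≤ C ^ e * ((f.coeff k).natAbs + 1) := by rw [mul_add, mul_one]; omega
        _ ≤ _ := Nat.mul_le_mul_left _ (hcoeff k)
    · rw [map_sub, map_mul, map_mul, aeval_X, hq, hfα, mul_zero, sub_zero, pow_succ']

end Powers

end Roth

/-! ### The auxiliary polynomial -/

namespace Roth

open Finset

/-- The auxiliary polynomial: large index at `(α, …, α)`, small coefficients. -/
lemma exists_auxiliary {K : Type*} [Field K] {α : K} (hα : IsIntegral ℤ α) {ε : ℝ}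
    (hε : 0 < ε) (hε2 : ε < 1 / 2) :
    ∃ (m : ℕ) (C : ℝ), 0 < m ∧ 0 < C ∧ ∀ r : Fin m → ℕ, (∀ j, 0 < r j) →
      ∃ P : MvPolynomial (Fin m) ℤ, P ≠ 0 ∧ Box r P ∧
        Real.log (len P) ≤ C * ∑ j, (r j : ℝ) ∧
        Ord (fun j => (r j : ℝ)⁻¹) (m * (1 / 2 - ε))
          (shift (fun _ => α) (P.map (Int.castRingHom K))) := by
  classical
  obtain ⟨d, D, hd, hD, hpow⟩ := exists_pow_eq_aeval hα
  choose q hq0 hqb hqα using hpow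
  have hd' : (0 : ℝ) < d := by exact_mod_cast hd
  have hD' : (1 : ℝ) ≤ D := by exact_mod_cast hD
  set m := ⌈Real.log (2 * d) / (2 * ε ^ 2)⌉₊ + 1 with hm
  have hm0 : (0 : ℝ) < m := by rw [hm]; positivity
  refine ⟨m, Real.log (8 * D), Nat.succ_pos _, Real.log_pos (by linarith), fun r hr => ?_⟩
  set B := (j : Fin m) → Fin (r j + 1) with hB
  set w : B → ℝ := fun i => ∑ j, (r j : ℝ)⁻¹ * (i j : ℕ) with hw
  set E := {i : B // w i < m * (1 / 2 - ε)} × Fin d with hE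
  let toF : B → Fin m →₀ ℕ := fun k => Finsupp.equivFunOnFinite.symm fun j => (k j : ℕ)
  have htoF : ∀ k j, toF k j = k j := fun _ _ => rfl
  have hinj : Function.Injective toF := fun k k' h => by
    funext j
    exact Fin.ext (by rw [← htoF, ← htoF, h])
  set S := ∑ j, r j with hS
  have htoF_sum : ∀ k, ∑ j, toF k j ≤ S := fun k =>
    sum_le_sum fun j _ => Nat.lt_succ_iff.mp (k j).2
  let A : Matrix E B ℤ := Matrix.of fun e k =>
    (mvChoose (toF k) (toF e.1.1) : ℤ) * (q (∑ j, toF k j - ∑ j, toF e.1.1 j)).coeff e.2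
  have hcardB : Fintype.card B = ∏ j, (r j + 1) := by simp [hB]
  have hcardB_le : Fintype.card B ≤ 2 ^ S := by
    rw [hcardB, hS, ← prod_pow_eq_pow_sum]
    exact prod_le_prod' fun j _ => Nat.lt_two_pow_self
  have hA : ∀ e k, (A e k).natAbs ≤ 2 ^ S * D ^ S := fun e k => by
    change ((mvChoose (toF k) (toF e.1.1) : ℤ) * _).natAbs ≤ _
    rw [Int.natAbs_mul, Int.natAbs_natCast]
    refine Nat.mul_le_mul ((mvChoose_le _ _).trans
      (Nat.pow_le_pow_right two_pos (htoF_sum k))) ((hqb _ _).trans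
      (Nat.pow_le_pow_right hD ((Nat.sub_le _ _).trans (htoF_sum k))))
  have hE0 : 0 < Fintype.card E := by
    have : Nonempty E := ⟨⟨⟨fun _ => 0, by
      simp only [hw, Fin.val_zero, Nat.cast_zero, mul_zero, sum_const_zero]
      exact mul_pos hm0 (by linarith)⟩, ⟨0, hd⟩⟩⟩
    exact Fintype.card_pos
  have hEB : 2 * Fintype.card E ≤ Fintype.card B := by
    have h1 := card_weight_lt_le r hr hε
    have h2 : Fintype.card E =
        #{i : B | ∑ j, (r j : ℝ)⁻¹ * (i j : ℕ) < m * (1 / 2 - ε)} * d := by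
      rw [Fintype.card_prod, Fintype.card_fin, Fintype.card_subtype]
    have h3 : 2 * d ≤ Real.exp (2 * ε ^ 2 * m) := by
      rw [← Real.log_le_iff_le_exp (by positivity), ← div_le_iff₀' (by positivity), hm]
      push_cast
      linarith [Nat.le_ceil (Real.log (2 * d) / (2 * ε ^ 2))]
    have h4 : (2 * Fintype.card E : ℝ) ≤ Fintype.card B := by
      rw [h2, hcardB]
      push_cast
      calc 2 * ((#{i : B | ∑ j, (r j : ℝ)⁻¹ * (i j : ℕ) < m * (1 / 2 - ε)} : ℝ) * d)
          ≤ 2 * ((∏ j, ((r j : ℝ) + 1)) * Real.exp (-(2 * ε ^ 2 * m)) * d) := by gcongr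
        _ = (∏ j, ((r j : ℝ) + 1)) * (Real.exp (-(2 * ε ^ 2 * m)) * (2 * d)) := by ring
        _ ≤ (∏ j, ((r j : ℝ) + 1)) *
            (Real.exp (-(2 * ε ^ 2 * m)) * Real.exp (2 * ε ^ 2 * m)) := by gcongr
        _ = _ := by rw [← Real.exp_add, neg_add_cancel, Real.exp_zero, mul_one]
    exact_mod_cast h4
  have hDS : 1 ≤ 2 ^ S * D ^ S := Nat.one_le_iff_ne_zero.mpr (by positivity)
  obtain ⟨c, hc, hAc, hcb⟩ := exists_mulVec_eq_zero A hDS hA hE0 hEB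
  set P : MvPolynomial (Fin m) ℤ := ∑ k : B, MvPolynomial.monomial (toF k) (c k) with hP
  have hcoeff : ∀ k, P.coeff (toF k) = c k := fun k => by
    rw [hP, MvPolynomial.coeff_sum, sum_eq_single k, MvPolynomial.coeff_monomial, if_pos rfl]
    · exact fun k' _ hne => by rw [MvPolynomial.coeff_monomial, if_neg fun h => hne (hinj h)]
    · exact fun h => absurd (mem_univ k) h
  have hsupp : P.support ⊆ univ.image toF := by
    intro i hi
    rw [MvPolynomial.mem_support_iff, hP, MvPolynomial.coeff_sum] at hi
    obtain ⟨k, -, hk⟩ := exists_ne_zero_of_sum_ne_zero hi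
    rw [MvPolynomial.coeff_monomial] at hk
    exact mem_image.mpr ⟨k, mem_univ _, by by_contra h; simp [h] at hk⟩
  have hP0 : P ≠ 0 := by
    intro h
    apply hc
    funext k
    rw [← hcoeff, h]
    simp
  refine ⟨P, hP0, fun i hi j => ?_, ?_, fun i hi => ?_⟩
  · obtain ⟨k, -, rfl⟩ := mem_image.mp (hsupp (MvPolynomial.mem_support_iff.mpr hi))
    exact Nat.lt_succ_iff.mp (k j).2
  · have h1 : len P ≤ (8 * D) ^ S := by
      rw [len_eq_sum hsupp, sum_image hinj.injOn]
      refine (sum_le_card_nsmul _ _ _ fun k _ => (hcoeff k ▸ hcb k)).trans ?_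
      rw [card_univ, smul_eq_mul]
      calc _ ≤ 2 ^ S * (2 ^ S * (2 ^ S * D ^ S)) := by gcongr
        _ = _ := by rw [show 8 * D = 2 * (2 * (2 * D)) by ring]; simp only [mul_pow]
    have h2 : (len P : ℝ) ≤ (8 * D : ℝ) ^ S := by exact_mod_cast h1
    have h3 := Real.log_le_log (by exact_mod_cast one_le_len hP0) h2
    rw [Real.log_pow] at h3
    rw [mul_comm]
    rw [hS] at h3
    exact_mod_cast h3
  · by_contra! hlt
    apply hi
    have hsupp' : (P.map (Int.castRingHom K)).support ⊆ univ.image toF :=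
      (MvPolynomial.support_map_subset _ _).trans hsupp
    rw [coeff_shift_of_subset _ _ _ hsupp', sum_image hinj.injOn]
    by_cases hbox : ∀ j, i j ≤ r j
    · set i₀ : B := fun j => ⟨i j, Nat.lt_succ_of_le (hbox j)⟩ with hi₀
      have hi₀i : toF i₀ = i := by
        ext j
        rfl
      have hrow : ∀ l : Fin d, ∑ k, (mvChoose (toF k) i : ℤ) *
          (q (∑ j, toF k j - ∑ j, i j)).coeff l * c k = 0 := by
        intro l
        have := congrFun hAc (⟨⟨i₀, hlt⟩, l⟩ : E)
        simpa only [Matrix.mulVec, dotProduct, A, Matrix.of_apply, hi₀i, Pi.zero_apply] using this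
      have hterm : ∀ k, (P.map (Int.castRingHom K)).coeff (toF k) *
          ((mvChoose (toF k) i : K) * ∏ j, α ^ (toF k j - i j)) =
          ∑ l : Fin d, (((mvChoose (toF k) i : ℤ) *
            (q (∑ j, toF k j - ∑ j, i j)).coeff l * c k : ℤ) : K) * α ^ (l : ℕ) := by
        intro k
        rw [MvPolynomial.coeff_map, hcoeff]
        by_cases hik : i ≤ toF k
        · have hexp : ∏ j, α ^ (toF k j - i j) = α ^ (∑ j, toF k j - ∑ j, i j) := by
            rw [prod_pow_eq_pow_sum, sum_tsub_distrib _ fun j _ => hik j]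
          have hdeg : (q (∑ j, toF k j - ∑ j, i j)).natDegree < d := by
            rw [← Nat.le_sub_one_iff_lt hd, natDegree_le_iff_coeff_eq_zero]
            exact fun N hN => hq0 _ _ (by omega)
          rw [hexp, ← hqα, aeval_eq_sum_range' hdeg, ← Fin.sum_univ_eq_sum_range
            (fun l => (q (∑ j, toF k j - ∑ j, i j)).coeff l • α ^ l), mul_sum, mul_sum]
          refine sum_congr rfl fun l _ => ?_
          rw [zsmul_eq_mul]
          push_cast
          rw [eq_intCast]
          ring
        · simp [mvChoose_eq_zero hik]
      rw [sum_congr rfl fun k _ => hterm k, sum_comm]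
      refine sum_eq_zero fun l _ => ?_
      rw [← sum_mul, ← Int.cast_sum, hrow l, Int.cast_zero, zero_mul]
    · refine sum_eq_zero fun k _ => ?_
      rw [mvChoose_eq_zero, Nat.cast_zero, zero_mul, mul_zero]
      intro hik
      exact hbox fun j => (hik j).trans (Nat.lt_succ_iff.mp (k j).2)

end Roth

/-! ### Ridout's theorem -/

namespace Roth

open Finset

/-- After clearing denominators, a Taylor coefficient of an integer polynomial at a rational point
is an integer of controlled size. -/
lemma exists_int_coeff_shift {σ : Type*} [Fintype σ] {r : σ → ℕ} {P : MvPolynomial σ ℤ}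
    (hP : Box r P) (β : σ → ℚ) (i : σ →₀ ℕ) :
    ∃ N : ℤ, (N : ℚ) = (shift β (P.map (Int.castRingHom ℚ))).coeff i * ∏ j, ((β j).den : ℚ) ^ r j ∧
      N.natAbs ≤ len P * 2 ^ (∑ j, r j) * ∏ j, ht (β j) ^ r j := by
  refine ⟨∑ k ∈ P.support, P.coeff k * ((mvChoose k i : ℤ) *
    ∏ j, (β j).num ^ (k j - i j) * ((β j).den : ℤ) ^ (r j - (k j - i j))), ?_, ?_⟩
  · rw [coeff_shift_of_subset β _ i (MvPolynomial.support_map_subset _ P), sum_mul]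
    push_cast
    refine sum_congr rfl fun k hk => ?_
    rw [MvPolynomial.coeff_map, eq_intCast, mul_assoc, mul_assoc, ← prod_mul_distrib]
    congr 2
    refine prod_congr rfl fun j _ => ?_
    have hle : k j - i j ≤ r j :=
      (Nat.sub_le _ _).trans (hP k (MvPolynomial.mem_support_iff.mp hk) j)
    have hden : ((β j).den : ℚ) ≠ 0 := by exact_mod_cast (β j).den_ne_zero
    conv_rhs => rw [← Nat.add_sub_cancel' hle, pow_add, ← mul_assoc, ← mul_pow, Rat.mul_den_eq_num]
  · refine (Int.natAbs_sum_le _ _).trans ?_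
    rw [len, mul_assoc, sum_mul]
    refine sum_le_sum fun k hk => ?_
    rw [Int.natAbs_mul, Int.natAbs_mul, Int.natAbs_natCast]
    have hkr := hP k (MvPolynomial.mem_support_iff.mp hk)
    refine Nat.mul_le_mul_left _ (Nat.mul_le_mul ((mvChoose_le k i).trans
      (Nat.pow_le_pow_right two_pos (sum_le_sum fun j _ => hkr j))) ?_)
    rw [← Int.natAbsHom_apply, map_prod]
    refine prod_le_prod' fun j _ => ?_
    have hle : k j - i j ≤ r j := (Nat.sub_le _ _).trans (hkr j)
    rw [Int.natAbsHom_apply, Int.natAbs_mul, Int.natAbs_pow, Int.natAbs_pow, Int.natAbs_natCast]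
    calc _ ≤ ht (β j) ^ (k j - i j) * ht (β j) ^ (r j - (k j - i j)) :=
          Nat.mul_le_mul (Nat.pow_le_pow_left (le_max_left _ _) _)
            (Nat.pow_le_pow_left (le_max_right _ _) _)
      _ = _ := by rw [← pow_add, Nat.add_sub_cancel' hle]

variable {p : ℕ} [hp : Fact p.Prime]

lemma one_le_natAbs_mul_norm {N : ℤ} (hN : N ≠ 0) : 1 ≤ (N.natAbs : ℝ) * ‖(N : ℚ_[p])‖ := by
  have hN' : (N : ℚ_[p]) ≠ 0 := by exact_mod_cast hN
  obtain ⟨v, hv⟩ : ∃ v : ℕ, ‖(N : ℚ_[p])‖ = (p : ℝ) ^ (-(v : ℤ)) :=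
    ⟨padicValInt p N, by rw [Padic.norm_eq_zpow_neg_valuation hN', Padic.valuation_intCast]⟩
  have hdvd := (Padic.norm_int_le_pow_iff_dvd N v).mp hv.le
  have hle : p ^ v ≤ N.natAbs := by
    refine Nat.le_of_dvd (Int.natAbs_pos.mpr hN) ?_
    have := Int.natAbs_dvd_natAbs.mpr hdvd
    simpa [Int.natAbs_pow] using this
  have hp0 : (0 : ℝ) < (p : ℝ) ^ v := pow_pos (by exact_mod_cast hp.out.pos) v
  rw [hv, zpow_neg, zpow_natCast, ← div_eq_mul_inv, le_div_iff₀ hp0, one_mul]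
  exact_mod_cast hle

lemma norm_le_one_of_isIntegral {α : ℚ_[p]} (hα : IsIntegral ℤ α) : ‖α‖ ≤ 1 := by
  obtain ⟨y, rfl⟩ := IsIntegrallyClosed.isIntegral_iff.mp (hα.tower_top (A := ℤ_[p]))
  exact y.2

lemma norm_coeff_shift_le {σ : Type*} [Fintype σ] {γ : σ → ℚ_[p]} {Q : MvPolynomial σ ℚ_[p]}
    (hQ : ∀ k, ‖Q.coeff k‖ ≤ 1) (i : σ →₀ ℕ) {M : ℝ} (hM : 0 ≤ M)
    (h : ∀ k, Q.coeff k ≠ 0 → i ≤ k → ∏ j, ‖γ j‖ ^ (k j - i j) ≤ M) :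
    ‖(shift γ Q).coeff i‖ ≤ M := by
  rw [coeff_shift]
  refine IsUltrametricDist.norm_sum_le_of_forall_le_of_nonneg hM fun k hk => ?_
  by_cases hik : i ≤ k
  · rw [norm_mul, norm_mul, norm_prod]
    simp only [norm_pow]
    have h1 : ‖((mvChoose k i : ℕ) : ℚ_[p])‖ ≤ 1 := by
      exact_mod_cast Padic.norm_int_le_one (p := p) (mvChoose k i)
    have h2 : 0 ≤ ∏ j, ‖γ j‖ ^ (k j - i j) := prod_nonneg fun j _ => by positivity
    calc _ ≤ 1 * (1 * ∏ j, ‖γ j‖ ^ (k j - i j)) := by gcongr; exact hQ k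
      _ ≤ M := by simpa using h k (MvPolynomial.mem_support_iff.mp hk) hik
  · rw [mvChoose_eq_zero hik]; simpa using hM

lemma norm_coeff_shift_le_one {σ : Type*} [Fintype σ] {γ : σ → ℚ_[p]} (hγ : ∀ j, ‖γ j‖ ≤ 1)
    {Q : MvPolynomial σ ℚ_[p]} (hQ : ∀ k, ‖Q.coeff k‖ ≤ 1) (i : σ →₀ ℕ) :
    ‖(shift γ Q).coeff i‖ ≤ 1 :=
  norm_coeff_shift_le hQ i zero_le_one fun _ _ _ =>
    prod_le_one (fun j _ => by positivity) fun j _ => pow_le_one₀ (norm_nonneg _) (hγ j)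

/-- The comparison of the size of a nonzero Taylor coefficient with its `p`-adic absolute value. -/
lemma le_log_of_ord_lt {m : ℕ} {α : ℚ_[p]} (hα : ‖α‖ ≤ 1) {r : Fin m → ℕ}
    {P : MvPolynomial (Fin m) ℤ} {β : Fin m → ℚ} {i : Fin m →₀ ℕ} {c L θ η : ℝ} (hc : 0 ≤ c)
    (hr : ∀ j, 0 < r j) (hP : Box r P)
    (hθ : Ord (fun j => (r j : ℝ)⁻¹) θ (shift (fun _ => α) (P.map (Int.castRingHom ℚ_[p]))))
    (hi : (shift β (P.map (Int.castRingHom ℚ))).coeff i ≠ 0)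
    (hη : ∑ j, (r j : ℝ)⁻¹ * i j ≤ η) (hL0 : 0 ≤ L) (hL : ∀ j, L ≤ r j * Real.log (ht (β j)))
    (hβ : ∀ j, ‖α - (β j : ℚ_[p])‖ ≤ Real.exp (-c * Real.log (ht (β j)))) :
    c * L * (θ - η) ≤ Real.log (len P) + (∑ j, (r j : ℝ)) +
      ∑ j, (r j : ℝ) * Real.log (ht (β j)) := by
  obtain ⟨N, hN, hNle⟩ := exists_int_coeff_shift hP β i
  have hden : ∏ j, ((β j).den : ℚ) ^ r j ≠ 0 :=
    prod_ne_zero_iff.mpr fun j _ => pow_ne_zero _ (by exact_mod_cast (β j).den_ne_zero)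
  have hN0 : N ≠ 0 := by
    have : (N : ℚ) ≠ 0 := hN ▸ mul_ne_zero hi hden
    exact_mod_cast this
  have hPlen : 0 < len P := one_le_len (by rintro rfl; simp at hi)
  have hht : ∀ j, (0 : ℝ) < ht (β j) := fun j => by exact_mod_cast ht_pos (β j)
  have hcoeff : ‖(((shift β (P.map (Int.castRingHom ℚ))).coeff i : ℚ) : ℚ_[p])‖ ≤
      Real.exp (-(c * L * (θ - η))) := by
    have hmap : (((shift β (P.map (Int.castRingHom ℚ))).coeff i : ℚ) : ℚ_[p]) =
        (shift (fun j => (β j : ℚ_[p]) - α) (shift (fun _ => α)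
          (P.map (Int.castRingHom ℚ_[p])))).coeff i := by
      rw [shift_shift]
      have h1 := map_shift (Rat.castHom ℚ_[p]) β (P.map (Int.castRingHom ℚ))
      rw [MvPolynomial.map_map] at h1
      have h2 := congrArg (MvPolynomial.coeff i) h1
      rw [MvPolynomial.coeff_map] at h2
      rw [show ((Rat.castHom ℚ_[p]).comp (Int.castRingHom ℚ)) = Int.castRingHom ℚ_[p] from
        RingHom.ext_int _ _] at h2
      rw [← Rat.coe_castHom, h2]
      congr 2
      exact congrArg _ (_root_.funext fun j => by simp)
    rw [hmap]
    refine norm_coeff_shift_le (norm_coeff_shift_le_one (fun _ => hα) fun k => ?_) i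
      (Real.exp_nonneg _) fun k hk hik => ?_
    · rw [MvPolynomial.coeff_map]; exact Padic.norm_int_le_one _
    · calc ∏ j, ‖(β j : ℚ_[p]) - α‖ ^ (k j - i j)
          ≤ ∏ j, Real.exp (-c * Real.log (ht (β j))) ^ (k j - i j) := by
            refine prod_le_prod (fun j _ => by positivity) fun j _ => ?_
            gcongr
            rw [norm_sub_rev]; exact hβ j
        _ = Real.exp (∑ j, ((k j - i j : ℕ) : ℝ) * (-c * Real.log (ht (β j)))) := by
            rw [Real.exp_sum]
            exact prod_congr rfl fun j _ => (Real.exp_nat_mul _ _).symm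
        _ ≤ _ := by
            rw [Real.exp_le_exp]
            have h1 : ∀ j, L * ((r j : ℝ)⁻¹ * k j - (r j : ℝ)⁻¹ * i j) ≤
                ((k j - i j : ℕ) : ℝ) * Real.log (ht (β j)) := by
              intro j
              have hrj : (0 : ℝ) < r j := by exact_mod_cast hr j
              have h2 : L * (r j : ℝ)⁻¹ ≤ Real.log (ht (β j)) := by
                rw [← div_eq_mul_inv, div_le_iff₀ hrj, mul_comm]; exact hL j
              have h3 : (0 : ℝ) ≤ ((k j - i j : ℕ) : ℝ) := Nat.cast_nonneg _
              have h4 := mul_le_mul_of_nonneg_left h2 h3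
              rw [Nat.cast_sub (hik j)] at h4 ⊢
              linarith
            have h5 := sum_le_sum fun j (_ : j ∈ univ) => h1 j
            rw [← mul_sum, sum_sub_distrib] at h5
            have h6 := hθ k hk
            have h7 : L * (θ - η) ≤ ∑ j, ((k j - i j : ℕ) : ℝ) * Real.log (ht (β j)) :=
              le_trans (mul_le_mul_of_nonneg_left (by linarith) hL0) h5
            have h8 := mul_le_mul_of_nonneg_left h7 hc
            have h9 : ∑ j, ((k j - i j : ℕ) : ℝ) * (-c * Real.log (ht (β j))) =
                -(c * ∑ j, ((k j - i j : ℕ) : ℝ) * Real.log (ht (β j))) := by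
              rw [mul_sum, ← sum_neg_distrib]
              exact sum_congr rfl fun j _ => by ring
            rw [h9]
            linarith
  have hnorm : ‖(N : ℚ_[p])‖ ≤ Real.exp (-(c * L * (θ - η))) := by
    have h1 : (N : ℚ_[p]) = (((shift β (P.map (Int.castRingHom ℚ))).coeff i : ℚ) : ℚ_[p]) *
        ((∏ j, ((β j).den : ℤ) ^ r j : ℤ) : ℚ_[p]) := by
      have := congrArg (fun x : ℚ => (x : ℚ_[p])) hN
      push_cast at this ⊢
      exact this
    rw [h1, norm_mul]
    exact (mul_le_of_le_one_right (norm_nonneg _) (Padic.norm_int_le_one _)).trans hcoeff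
  have hNpos : (0 : ℝ) < N.natAbs := by exact_mod_cast Int.natAbs_pos.mpr hN0
  have h1 : 1 ≤ (N.natAbs : ℝ) * Real.exp (-(c * L * (θ - η))) :=
    (one_le_natAbs_mul_norm (p := p) hN0).trans (by gcongr)
  have h2 : c * L * (θ - η) ≤ Real.log N.natAbs := by
    rw [Real.exp_neg, ← div_eq_mul_inv, one_le_div (Real.exp_pos _)] at h1
    rwa [Real.le_log_iff_exp_le hNpos]
  have h3 : (N.natAbs : ℝ) ≤ len P * 2 ^ (∑ j, r j) * ∏ j, (ht (β j) : ℝ) ^ r j := by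
    exact_mod_cast hNle
  have h4 := Real.log_le_log hNpos h3
  have hlenR : (0 : ℝ) < len P := by exact_mod_cast hPlen
  have hprod : (0 : ℝ) < ∏ j, (ht (β j) : ℝ) ^ r j := prod_pos fun j _ => pow_pos (hht j) _
  rw [Real.log_mul (by positivity) hprod.ne', Real.log_mul hlenR.ne' (by positivity),
    Real.log_pow, Real.log_prod (fun j _ => (pow_pos (hht j) _).ne')] at h4
  simp only [Real.log_pow] at h4
  push_cast at h4
  have h5 : (∑ j, (r j : ℝ)) * Real.log 2 ≤ ∑ j, (r j : ℝ) :=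
    mul_le_of_le_one_right (sum_nonneg fun j _ => by positivity)
      (by linarith [Real.log_two_lt_d9])
  linarith

lemma finite_setOf_log_ht_le (X : ℝ) : {β : ℚ | Real.log (ht β) ≤ X}.Finite := by
  obtain ⟨M, hM⟩ := exists_nat_ge (Real.exp X)
  have hfin : (Set.Icc (-(M : ℤ)) M ×ˢ Set.Iic M).Finite :=
    (Set.finite_Icc _ _).prod (Set.finite_Iic _)
  refine Set.Finite.of_finite_image (f := fun β : ℚ => (β.num, β.den)) (hfin.subset ?_) ?_
  · rintro _ ⟨β, hβ, rfl⟩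
    have h1 : (ht β : ℝ) ≤ M := by
      have h0 : (0 : ℝ) < ht β := by exact_mod_cast ht_pos β
      exact ((Real.log_le_iff_le_exp h0).mp hβ).trans hM
    have h2 : ht β ≤ M := by exact_mod_cast h1
    have h3 : β.num.natAbs ≤ ht β := le_max_left _ _
    have h4 : β.den ≤ ht β := le_max_right _ _
    refine ⟨⟨?_, ?_⟩, ?_⟩ <;> simp only [Set.mem_Iic] <;> omega
  · intro β _ γ _ h
    rw [Prod.mk.injEq] at h
    exact Rat.ext h.1 h.2

lemma exists_seq_of_unbounded {ι : Type*} {s : Set ι} {f : ι → ℝ} {X K : ℝ} (hX : 0 ≤ X)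
    (hK : 1 ≤ K) (hs : ∀ Y, ∃ x ∈ s, Y ≤ f x) :
    ∃ b : ℕ → ι, (∀ i, b i ∈ s) ∧ (∀ i, X ≤ f (b i)) ∧ ∀ i j, i < j → K * f (b i) ≤ f (b j) := by
  choose g hg hgf using hs
  obtain ⟨b, hb, hb0, hbK⟩ : ∃ b : ℕ → ι, (∀ i, b i ∈ s) ∧ X ≤ f (b 0) ∧
      ∀ i, K * f (b i) ≤ f (b (i + 1)) := by
    refine ⟨Nat.rec (g X) fun _ x => g (K * f x), fun i => ?_, hgf _, fun i => hgf _⟩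
    cases i <;> exact hg _
  have hle : ∀ y, 0 ≤ y → y ≤ K * y := fun y hy => le_mul_of_one_le_left hy hK
  have hbX : ∀ i, X ≤ f (b i) := by
    intro i
    induction i with
    | zero => exact hb0
    | succ i ih => exact (ih.trans (hle _ (hX.trans ih))).trans (hbK i)
  refine ⟨b, hb, hbX, fun i j hij => ?_⟩
  induction j, hij using Nat.le_induction with
  | base => exact hbK i
  | succ j _ ih => exact (ih.trans (hle _ (hX.trans (hbX j)))).trans (hbK j)

/-- Ridout's theorem: a `p`-adic algebraic integer has only finitely many rational approximations
of exponent larger than two. -/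
theorem finite_setOf_norm_sub_le {α : ℚ_[p]} (hα : IsIntegral ℤ α) {δ : ℝ} (hδ : 0 < δ) :
    {β : ℚ | ‖α - (β : ℚ_[p])‖ ≤ Real.exp (-(2 + δ) * Real.log (ht β))}.Finite := by
  by_contra hinf
  have hlarge : ∀ X : ℝ, ∃ β : ℚ, ‖α - (β : ℚ_[p])‖ ≤ Real.exp (-(2 + δ) * Real.log (ht β)) ∧
      X ≤ Real.log (ht β) := by
    intro X
    by_contra! hX
    exact hinf ((finite_setOf_log_ht_le X).subset fun β hβ => (hX β hβ).le)
  obtain ⟨ε, hεdef⟩ : ∃ ε : ℝ, ε = δ / (4 * (6 + 2 * δ)) := ⟨_, rfl⟩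
  have hε0 : 0 < ε := by rw [hεdef]; positivity
  have hε8 : ε < 1 / 8 := by
    rw [hεdef, div_lt_div_iff₀ (by positivity) (by norm_num)]; linarith
  have hεδ : 4 * ε * (6 + 2 * δ) = δ := by rw [hεdef]; field_simp
  obtain ⟨m, C, hm, hC, haux⟩ := exists_auxiliary hα hε0 (by linarith : ε < 1 / 2)
  have hmR : (0 : ℝ) < m := by exact_mod_cast hm
  obtain ⟨ω, hω, hindex⟩ := exists_indexBound m (mul_pos hmR hε0)
  obtain ⟨X, hXdef⟩ : ∃ X : ℝ, X = 1 + 2 * m * (C + 1) / ω + 2 * (C + 1) / ε + 2 / ω := ⟨_, rfl⟩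
  have hX0 : 0 < X := by rw [hXdef]; positivity
  have hXω : 2 * m * C ≤ ω * X := by
    have : ω * X = ω + 2 * m * (C + 1) + ω * (2 * (C + 1) / ε) + 2 := by
      rw [hXdef]; field_simp
    have h1 : 0 < ω * (2 * (C + 1) / ε) := by positivity
    linarith
  have hXω2 : 2 ≤ ω * X := by
    have : ω * X = ω + 2 * m * (C + 1) + ω * (2 * (C + 1) / ε) + 2 := by
      rw [hXdef]; field_simp
    have h1 : 0 < ω * (2 * (C + 1) / ε) := by positivity
    have h2 : 0 < 2 * m * (C + 1) := by positivity
    linarith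
  have hXε : 2 * (C + 1) ≤ ε * X := by
    have : ε * X = ε + ε * (2 * m * (C + 1) / ω) + 2 * (C + 1) + ε * (2 / ω) := by
      rw [hXdef]; field_simp
    have h1 : 0 < ε * (2 * m * (C + 1) / ω) := by positivity
    have h2 : 0 < ε * (2 / ω) := by positivity
    linarith
  obtain ⟨K, hK1, hKω⟩ : ∃ K : ℝ, 1 ≤ K ∧ 2 / ω ≤ K :=
    ⟨max 1 (2 / ω), le_max_left _ _, le_max_right _ _⟩
  obtain ⟨b, hb, hbX', hbmono⟩ := exists_seq_of_unbounded hX0.le hK1 hlarge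
  obtain ⟨β, hβdef⟩ : ∃ β : Fin m → ℚ, ∀ j, β j = b (m - 1 - j) := ⟨_, fun _ => rfl⟩
  obtain ⟨h, hh⟩ : ∃ h : Fin m → ℝ, ∀ j, h j = Real.log (ht (β j)) := ⟨_, fun _ => rfl⟩
  have hhX : ∀ j, X ≤ h j := fun j => by
    rw [hh, hβdef]; exact hbX' _
  have hh0 : ∀ j, 0 < h j := fun j => hX0.trans_le (hhX j)
  have hhK : ∀ i j, i < j → 2 / ω * h j ≤ h i := by
    intro i j hij
    refine (mul_le_mul_of_nonneg_right hKω (hh0 j).le).trans ?_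
    rw [hh, hh, hβdef, hβdef]
    exact hbmono _ _ (by omega)
  obtain ⟨L, hLdef⟩ : ∃ L : ℝ, L = (∑ j, h j) / ε := ⟨_, rfl⟩
  have hsum0 : 0 < ∑ j, h j := sum_pos (fun j _ => hh0 j) ⟨⟨0, hm⟩, mem_univ _⟩
  have hL0 : 0 < L := hLdef ▸ div_pos hsum0 hε0
  have hhL : ∀ j, h j ≤ ε * L := by
    intro j
    have : ε * L = ∑ j, h j := by rw [hLdef]; field_simp
    rw [this]
    exact single_le_sum (fun j _ => (hh0 j).le) (mem_univ j)
  obtain ⟨r, hrdef⟩ : ∃ r : Fin m → ℕ, ∀ j, r j = ⌈L / h j⌉₊ := ⟨_, fun _ => rfl⟩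
  have hrL : ∀ j, L ≤ r j * h j := fun j =>
    (div_le_iff₀ (hh0 j)).mp (hrdef j ▸ Nat.le_ceil _)
  have hrU : ∀ j, (r j : ℝ) * h j ≤ L + h j := by
    intro j
    have h1 : (r j : ℝ) ≤ L / h j + 1 :=
      hrdef j ▸ (Nat.ceil_lt_add_one (by have := hh0 j; positivity)).le
    calc (r j : ℝ) * h j ≤ (L / h j + 1) * h j := mul_le_mul_of_nonneg_right h1 (hh0 j).le
      _ = L + h j := by have := (hh0 j).ne'; field_simp
  have hr2 : ∀ j, (r j : ℝ) * h j ≤ 2 * L := fun j => by nlinarith [hrU j, hhL j]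
  have hr0 : ∀ j, 0 < r j := fun j => hrdef j ▸ Nat.ceil_pos.mpr (div_pos hL0 (hh0 j))
  have hrX : ∀ j, (r j : ℝ) * X ≤ 2 * L := fun j =>
    (mul_le_mul_of_nonneg_left (hhX j) (Nat.cast_nonneg _)).trans (hr2 j)
  have hS : (∑ j, (r j : ℝ)) * X ≤ m * (2 * L) := by
    rw [sum_mul]
    refine (sum_le_sum fun j _ => hrX j).trans ?_
    simp
  have hSnn : 0 ≤ ∑ j, (r j : ℝ) := sum_nonneg fun j _ => Nat.cast_nonneg _
  have hrL' : ∀ j, L ≤ r j * Real.log (ht (β j)) := fun j => hh j ▸ hrL j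
  obtain ⟨P, hP0, hPbox, hPlen, hPord⟩ := haux r hr0
  have hlenω : Real.log (len P) ≤ ω * L := by
    refine hPlen.trans ?_
    have h1 : C * (∑ j, (r j : ℝ)) * X ≤ ω * L * X := by nlinarith
    exact le_of_mul_le_mul_right h1 hX0
  have hnot := hindex r β L P hP0 hPbox hr0 (fun i j hij => ?_) hrL' (fun j => ?_) hlenω
  · simp only [Ord, not_forall, not_le] at hnot
    obtain ⟨i, hi, hilt⟩ := hnot
    have hmain := le_log_of_ord_lt (norm_le_one_of_isIntegral hα) (by linarith : (0 : ℝ) ≤ 2 + δ)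
      hr0 hPbox hPord hi hilt.le hL0.le hrL' (fun j => by rw [hβdef]; exact hb _)
    have h1 : ∑ j, (r j : ℝ) * Real.log (ht (β j)) ≤ m * ((1 + ε) * L) := by
      simp only [← hh]
      refine (sum_le_sum fun j _ => (hrU j).trans
        (by linarith [hhL j] : L + h j ≤ (1 + ε) * L)).trans ?_
      simp
    have h2 : (C + 1) * (∑ j, (r j : ℝ)) ≤ m * (ε * L) := by
      have h3 : (C + 1) * (∑ j, (r j : ℝ)) * X ≤ m * (ε * L) * X := by
        have h4 := mul_le_mul_of_nonneg_left hS (by linarith : 0 ≤ C + 1)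
        have h5 := mul_le_mul_of_nonneg_left hXε (by positivity : 0 ≤ m * L)
        linarith
      exact le_of_mul_le_mul_right h3 hX0
    have h3 : (2 + δ) * L * (m * (1 / 2 - ε) - m * ε) ≤ m * L * (1 + 2 * ε) := by linarith
    have h4 : m * L * ((2 + δ) * (1 / 2 - 2 * ε)) ≤ m * L * (1 + 2 * ε) := by linarith
    have h5 := le_of_mul_le_mul_left h4 (by positivity)
    nlinarith
  · have h1 := hhK i j hij
    have h2 : (r i : ℝ) * h i ≤ ω * r j * h i := by
      have h3 : 2 * h j ≤ ω * h i := by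
        rw [div_mul_eq_mul_div, div_le_iff₀ hω] at h1; linarith
      have h4 := hr2 i
      have h5 := hrL j
      have h6 := mul_le_mul_of_nonneg_left h3 (Nat.cast_nonneg (r j) : (0 : ℝ) ≤ r j)
      linarith
    exact le_of_mul_le_mul_right h2 (hh0 i)
  · have h1 : (r j : ℝ) * X ≤ ω * L * X := by
      have := mul_le_mul_of_nonneg_left hXω2 hL0.le
      linarith [hrX j]
    exact le_of_mul_le_mul_right h1 hX0

end Roth

/-! ### Convergents of Ruban continued fractions -/

namespace Roth

open Finset

section Convergents

lemma num_nonneg_of_mem {p : ℕ} {b : ℚ} (hb : b ∈ Sp p) : 0 ≤ b.num := Rat.num_nonneg.mpr hb.2.1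

lemma num_lt_of_mem {p : ℕ} {b : ℚ} (hb : b ∈ Sp p) : b.num < p * b.den := by
  have h1 := hb.2.2
  have hd : (0 : ℚ) < b.den := by exact_mod_cast b.den_pos
  rw [← Rat.num_div_den b, div_lt_iff₀ hd] at h1
  exact_mod_cast h1

variable {p : ℕ} [hp : Fact p.Prime]

/-- `Q` and `R` are the denominators and numerators of the convergents of the `p`-adic continued
fraction with partial quotients `x`, with indices shifted by one. -/
structure IsConvergents (x Q R : ℕ → ℚ_[p]) : Prop where
  norm_ge : ∀ m, 1 ≤ m → (p : ℝ) ≤ ‖x m‖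
  den_zero : Q 0 = 0
  den_one : Q 1 = 1
  num_zero : R 0 = 1
  den_rec : ∀ m, Q (m + 2) = x (m + 1) * Q (m + 1) + Q m
  num_rec : ∀ m, R (m + 2) = x (m + 1) * R (m + 1) + R m

lemma block_const {x Q : ℕ → ℚ_[p]}
    (hQ : ∀ m, Q (m + 2) = x (m + 1) * Q (m + 1) + Q m) {m M : ℕ} (hmM : m ≤ M)
    (hx : ∀ j, m < j → j ≤ M → x j = p - (p : ℚ_[p])⁻¹) :
    Q (M + 1) - p * Q M = (-(p : ℚ_[p])⁻¹) ^ (M - m) * (Q (m + 1) - p * Q m) := by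
  have hp0 : (p : ℚ_[p]) ≠ 0 := by exact_mod_cast hp.out.ne_zero
  induction M, hmM using Nat.le_induction with
  | base => simp
  | succ M hM ih =>
    have h1 := ih fun j hj hjM => hx j hj (hjM.trans M.le_succ)
    rw [hQ, hx _ (by omega) le_rfl, Nat.succ_sub hM, pow_succ', mul_assoc, ← h1]
    field_simp
    ring

namespace IsConvergents

variable {x Q R : ℕ → ℚ_[p]}

lemma norm_den_lt_and_norm_den_eq (h : IsConvergents x Q R) (m : ℕ) :
    ‖Q m‖ < ‖Q (m + 1)‖ ∧ ‖Q (m + 2)‖ = ‖x (m + 1)‖ * ‖Q (m + 1)‖ := by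
  have hp1 : (1 : ℝ) < p := by exact_mod_cast hp.out.one_lt
  have key : ∀ m, ‖Q m‖ < ‖Q (m + 1)‖ → ‖Q (m + 1)‖ < ‖x (m + 1)‖ * ‖Q (m + 1)‖ ∧
      ‖Q (m + 2)‖ = ‖x (m + 1)‖ * ‖Q (m + 1)‖ := by
    intro m hm
    have h0 : 0 < ‖Q (m + 1)‖ := (norm_nonneg _).trans_lt hm
    have h1 : ‖Q (m + 1)‖ < ‖x (m + 1)‖ * ‖Q (m + 1)‖ :=
      lt_mul_of_one_lt_left h0 (hp1.trans_le (h.norm_ge _ (by omega)))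
    refine ⟨h1, ?_⟩
    rw [h.den_rec, Padic.add_eq_max_of_ne (by rw [norm_mul]; exact (hm.trans h1).ne'), norm_mul]
    exact max_eq_left (hm.trans h1).le
  have hlt : ∀ m, ‖Q m‖ < ‖Q (m + 1)‖ := by
    intro m
    induction m with
    | zero => simp [h.den_zero, h.den_one]
    | succ m ih => rw [(key m ih).2]; exact (key m ih).1
  exact ⟨hlt m, (key m (hlt m)).2⟩

lemma norm_den_lt (h : IsConvergents x Q R)
    (m : ℕ) : ‖Q m‖ < ‖Q (m + 1)‖ := (h.norm_den_lt_and_norm_den_eq m).1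

lemma norm_den_eq (h : IsConvergents x Q R) (m : ℕ) : ‖Q (m + 2)‖ = ‖x (m + 1)‖ * ‖Q (m + 1)‖ :=
  (h.norm_den_lt_and_norm_den_eq m).2

lemma norm_den_pos (h : IsConvergents x Q R)
    (m : ℕ) : 0 < ‖Q (m + 1)‖ := (norm_nonneg _).trans_lt (h.norm_den_lt m)

lemma den_ne_zero (h : IsConvergents x Q R)
    (m : ℕ) : Q (m + 1) ≠ 0 := norm_pos_iff.mp (h.norm_den_pos m)

lemma pow_le_norm_den (h : IsConvergents x Q R) (m : ℕ) : (p : ℝ) ^ m ≤ ‖Q (m + 1)‖ := by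
  induction m with
  | zero => simp [h.den_one]
  | succ m ih =>
    rw [h.norm_den_eq, pow_succ']
    gcongr
    exact h.norm_ge _ (by omega)

lemma det_eq (h : IsConvergents x Q R)
    (m : ℕ) : R (m + 1) * Q m - R m * Q (m + 1) = (-1) ^ (m + 1) := by
  induction m with
  | zero => simp [h.den_zero, h.den_one, h.num_zero]
  | succ m ih =>
    rw [h.den_rec, h.num_rec, pow_succ, ← ih]
    ring

lemma norm_convergent_succ_sub (h : IsConvergents x Q R) (m : ℕ) :
    ‖R (m + 2) / Q (m + 2) - R (m + 1) / Q (m + 1)‖ = (‖Q (m + 1)‖ * ‖Q (m + 2)‖)⁻¹ := by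
  rw [div_sub_div _ _ (h.den_ne_zero _) (h.den_ne_zero _), mul_comm (Q (m + 2)), h.det_eq,
    norm_div, norm_mul, norm_pow, norm_neg, norm_one, one_pow, one_div, mul_comm]

lemma inv_norm_den_antitone (h : IsConvergents x Q R) :
    Antitone fun m => (‖Q (m + 1)‖ * ‖Q (m + 2)‖)⁻¹ :=
  antitone_nat_of_succ_le fun _ => inv_anti₀ (mul_pos (h.norm_den_pos _) (h.norm_den_pos _))
    (mul_le_mul (h.norm_den_lt _).le (h.norm_den_lt _).le (norm_nonneg _) (norm_nonneg _))

lemma norm_limit_sub_le (h : IsConvergents x Q R) {α : ℚ_[p]}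
    (hα : Tendsto (fun m => R (m + 1) / Q (m + 1)) atTop (nhds α)) (m : ℕ) :
    ‖α - R (m + 1) / Q (m + 1)‖ ≤ (‖Q (m + 1)‖ * ‖Q (m + 2)‖)⁻¹ := by
  refine le_of_tendsto (hα.sub_const _).norm ?_
  filter_upwards [eventually_ge_atTop m] with s hs
  induction s, hs using Nat.le_induction with
  | base => rw [sub_self, norm_zero]; positivity
  | succ s hs ih =>
    rw [← sub_add_sub_cancel _ (R (s + 1) / Q (s + 1))]
    refine (IsUltrametricDist.norm_add_le_max _ _).trans (max_le ?_ ih)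
    rw [h.norm_convergent_succ_sub]
    exact h.inv_norm_den_antitone hs

lemma norm_den_sub (h : IsConvergents x Q R) (m : ℕ) : ‖Q (m + 1) - p * Q m‖ = ‖Q (m + 1)‖ := by
  have h1 : ‖(p : ℚ_[p]) * Q m‖ < ‖Q (m + 1)‖ := by
    rw [norm_mul]
    exact (mul_le_of_le_one_left (norm_nonneg _)
      (by exact_mod_cast Padic.norm_int_le_one (p := p) p)).trans_lt (h.norm_den_lt m)
  rw [sub_eq_add_neg, Padic.add_eq_max_of_ne (by rw [norm_neg]; exact h1.ne'), norm_neg]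
  exact max_eq_left h1.le

lemma den_sub_ne_zero (h : IsConvergents x Q R) (m : ℕ) : Q (m + 1) - p * Q m ≠ 0 := by
  rw [← norm_pos_iff, h.norm_den_sub]
  exact h.norm_den_pos m

/-- Both the limit and the value with all later quotients equal to `p - p⁻¹` are well approximated
by a convergent. -/
lemma norm_limit_sub_block_le (h : IsConvergents x Q R) {α : ℚ_[p]}
    (hα : Tendsto (fun m => R (m + 1) / Q (m + 1)) atTop (nhds α)) (m : ℕ) :
    ‖α - (R (m + 1) - p * R m) / (Q (m + 1) - p * Q m)‖ ≤ (((p : ℝ) ^ m) ^ 2)⁻¹ := by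
  have hpm : (0 : ℝ) < (p : ℝ) ^ m := pow_pos (by exact_mod_cast hp.out.pos) m
  have hq : ((p : ℝ) ^ m) ^ 2 ≤ ‖Q (m + 1)‖ * ‖Q (m + 1)‖ := by
    rw [sq]
    exact mul_self_le_mul_self hpm.le (h.pow_le_norm_den m)
  rw [← sub_add_sub_cancel _ (R (m + 1) / Q (m + 1))]
  refine (IsUltrametricDist.norm_add_le_max _ _).trans (max_le ?_ ?_)
  · refine (h.norm_limit_sub_le hα m).trans (inv_anti₀ (by positivity) (hq.trans ?_))
    exact mul_le_mul_of_nonneg_left (h.norm_den_lt _).le (norm_nonneg _)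
  · rw [div_sub_div _ _ (h.den_ne_zero _) (h.den_sub_ne_zero _), norm_div, norm_mul,
      h.norm_den_sub, div_eq_mul_inv]
    have h1 : R (m + 1) * (Q (m + 1) - p * Q m) - Q (m + 1) * (R (m + 1) - p * R m) =
        -(p * (-1) ^ (m + 1)) := by rw [← h.det_eq]; ring
    have h2 : ‖(p : ℚ_[p])‖ ≤ 1 := by exact_mod_cast Padic.norm_int_le_one (p := p) p
    rw [h1, norm_neg, norm_mul, norm_pow, norm_neg, norm_one, one_pow, mul_one]
    refine (mul_le_of_le_one_left (by positivity) h2).trans (inv_anti₀ (by positivity) hq)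

lemma block_div_const (h : IsConvergents x Q R) {m M : ℕ} (hmM : m ≤ M)
    (hx : ∀ j, m < j → j ≤ M → x j = p - (p : ℚ_[p])⁻¹) :
    (R (M + 1) - p * R M) / (Q (M + 1) - p * Q M) =
      (R (m + 1) - p * R m) / (Q (m + 1) - p * Q m) := by
  have hp0 : (p : ℚ_[p]) ≠ 0 := by exact_mod_cast hp.out.ne_zero
  rw [block_const h.den_rec hmM hx, block_const h.num_rec hmM hx,
    mul_div_mul_left _ _ (pow_ne_zero _ (neg_ne_zero.mpr (inv_ne_zero hp0)))]

lemma norm_one_add_mul_le (h : IsConvergents x Q R) {α : ℚ_[p]}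
    (hα : Tendsto (fun m => R (m + 1) / Q (m + 1)) atTop (nhds α)) {m : ℕ}
    (hm : α = (R (m + 1) - p * R m) / (Q (m + 1) - p * Q m)) :
    ‖1 + p * x (m + 1)‖ * ‖x (m + 1)‖ * p ≤ 1 := by
  have h1 := h.norm_limit_sub_le hα (m + 1)
  rw [hm, div_sub_div _ _ (h.den_sub_ne_zero _) (h.den_ne_zero _), norm_div, norm_mul,
    h.norm_den_sub] at h1
  have h2 : (R (m + 1) - p * R m) * Q (m + 2) - (Q (m + 1) - p * Q m) * R (m + 2) =
      (-1) ^ (m + 1) * (1 + p * x (m + 1)) := by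
    rw [← h.det_eq, h.den_rec, h.num_rec]; ring
  rw [h2, norm_mul, norm_pow, norm_neg, norm_one, one_pow, one_mul, h.norm_den_eq (m + 1),
    h.norm_den_eq m] at h1
  have hq := h.norm_den_pos m
  have hp1 : (0 : ℝ) < p := by exact_mod_cast hp.out.pos
  have hx1 : 0 < ‖x (m + 1)‖ := hp1.trans_le (h.norm_ge _ (by omega))
  have hx2 : (p : ℝ) ≤ ‖x (m + 1 + 1)‖ := h.norm_ge _ (by omega)
  have hx3 : 0 < ‖x (m + 1 + 1)‖ := hp1.trans_le hx2
  rw [div_le_iff₀ (by positivity)] at h1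
  have h3 : (‖x (m + 1)‖ * ‖Q (m + 1)‖ * (‖x (m + 1 + 1)‖ * (‖x (m + 1)‖ * ‖Q (m + 1)‖)))⁻¹ *
      (‖Q (m + 1)‖ * (‖x (m + 1)‖ * ‖Q (m + 1)‖)) = (‖x (m + 1)‖ * ‖x (m + 1 + 1)‖)⁻¹ := by
    field_simp
  rw [h3, ← one_div, le_div_iff₀ (by positivity), ← mul_assoc] at h1
  exact (mul_le_mul_of_nonneg_left hx2 (by positivity)).trans h1

end IsConvergents

lemma exists_den_eq_pow {b : ℚ} (hb : b ∈ Sp p) : ∃ v : ℕ, b.den = p ^ v := by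
  obtain ⟨⟨k, z, hz⟩, -, -⟩ := hb
  have hp0 : (p : ℚ) ^ k ≠ 0 := pow_ne_zero _ (by exact_mod_cast hp.out.ne_zero)
  have hbz : b = ((z : ℤ) : ℚ) / ((p ^ k : ℕ) : ℤ) := by
    rw [hz]; push_cast; field_simp
  have hdvd : (b.den : ℤ) ∣ ((p ^ k : ℕ) : ℤ) := by
    rw [hbz, ← Rat.divInt_eq_div]
    exact Rat.den_dvd _ _
  obtain ⟨v, -, hv⟩ := (Nat.dvd_prime_pow hp.out).mp (Int.natCast_dvd_natCast.mp hdvd)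
  exact ⟨v, hv⟩

lemma norm_eq_den {b : ℚ} (hb : b ∈ Sp p) (hden : b.den ≠ 1) : ‖(b : ℚ_[p])‖ = b.den := by
  obtain ⟨v, hv⟩ := exists_den_eq_pow hb
  have hv0 : v ≠ 0 := by rintro rfl; exact hden (by simpa using hv)
  have hnum : ‖(b.num : ℚ_[p])‖ = 1 := by
    refine le_antisymm (Padic.norm_int_le_one _) (not_lt.mp fun hlt => ?_)
    rw [Padic.norm_intCast_lt_one_iff] at hlt
    have h1 : p ∣ b.num.natAbs := Int.natCast_dvd.mp hlt
    have h2 : p ∣ b.den := hv ▸ dvd_pow_self p hv0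
    exact hp.out.one_lt.ne' (Nat.eq_one_of_dvd_coprimes b.reduced h1 h2)
  have h1 : (b : ℚ_[p]) = (b.num : ℚ_[p]) / (p : ℚ_[p]) ^ v := by
    conv_lhs => rw [← Rat.num_div_den b, hv]
    push_cast
    rfl
  rw [h1, norm_div, hnum, norm_pow, Padic.norm_p, hv]
  simp

lemma norm_ge_of_mem {b : ℚ} (hb : b ∈ Sp' p) : (p : ℝ) ≤ ‖(b : ℚ_[p])‖ := by
  rw [Padic.eq_padicNorm]
  exact_mod_cast hb.2

lemma eq_sub_inv_of_norm_le {b : ℚ} (hb : b ∈ Sp' p)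
    (h : ‖(1 + p * b : ℚ_[p])‖ * ‖(b : ℚ_[p])‖ * p ≤ 1) : b = p - (p : ℚ)⁻¹ := by
  have hp1 : (1 : ℝ) < p := by exact_mod_cast hp.out.one_lt
  have hp0 : (p : ℚ) ≠ 0 := by exact_mod_cast hp.out.ne_zero
  have hnorm := norm_ge_of_mem hb
  have hlt : ‖(1 + p * b : ℚ_[p])‖ < 1 := by
    by_contra! hge
    have h1 : 1 < ‖(b : ℚ_[p])‖ := hp1.trans_le hnorm
    nlinarith [mul_le_mul_of_nonneg_right hge (norm_nonneg (b : ℚ_[p]))]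
  have hpb : ‖(p * b : ℚ_[p])‖ = 1 := by
    by_contra hne
    have h1 := Padic.add_eq_max_of_ne (q := (1 : ℚ_[p])) (r := p * b)
      (by rw [norm_one]; exact fun h => hne h.symm)
    rw [h1, norm_one] at hlt
    exact absurd hlt (not_lt.mpr (le_max_left _ _))
  rw [norm_mul, Padic.norm_p, inv_mul_eq_one₀ (by linarith)] at hpb
  have hden1 : b.den ≠ 1 := by
    intro h1
    have h2 : (b : ℚ_[p]) = (b.num : ℚ_[p]) := by
      conv_lhs => rw [← Rat.num_div_den b, h1]
      simp
    have h3 := Padic.norm_int_le_one (p := p) b.num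
    rw [← h2] at h3
    linarith
  have hden : b.den = p := by
    have := norm_eq_den hb.1 hden1
    rw [← hpb] at this
    exact_mod_cast this.symm
  have hbp : b = b.num / p := by
    conv_lhs => rw [← Rat.num_div_den b, hden]
  have hcast : (1 + p * b : ℚ_[p]) = ((1 + b.num : ℤ) : ℚ_[p]) := by
    have h1 : (1 + p * b : ℚ) = ((1 + b.num : ℤ) : ℚ) := by
      conv_lhs => rw [hbp]
      push_cast
      field_simp
    exact_mod_cast congrArg (fun y : ℚ => (y : ℚ_[p])) h1
  have hdvd : (p : ℤ) ^ 2 ∣ 1 + b.num := by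
    rw [← Padic.norm_int_le_pow_iff_dvd, ← hcast, zpow_neg, Nat.cast_ofNat, ← one_div,
      le_div_iff₀ (by positivity)]
    rw [← hpb] at h
    refine le_trans (le_of_eq ?_) h
    rw [zpow_ofNat]
    ring
  have hle := Int.le_of_dvd (by have := num_nonneg_of_mem hb.1; omega) hdvd
  have hlt := num_lt_of_mem hb.1
  rw [hden] at hlt
  have hnum : b.num = (p : ℤ) ^ 2 - 1 := by nlinarith
  rw [hbp, hnum]
  push_cast
  field_simp

lemma ht_div_le {u v : ℤ} (hv : v ≠ 0) : ht ((u : ℚ) / v) ≤ max u.natAbs v.natAbs := by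
  have hv' := Int.natAbs_pos.mpr hv
  rw [← Rat.divInt_eq_div]
  refine max_le ?_ ((Nat.le_of_dvd hv' (Int.natCast_dvd.mp (Rat.den_dvd u v))).trans
    (le_max_right _ _))
  obtain rfl | hu := eq_or_ne u 0
  · simp
  · exact (Nat.le_of_dvd (Int.natAbs_pos.mpr hu)
      (Int.natAbs_dvd_natAbs.mpr (Rat.num_dvd u hv))).trans (le_max_left _ _)

end Convergents

end Roth

/-! ### Approximation by block values -/

namespace Roth

open Finset

/-- Numerators and denominators of convergents, after clearing denominators, grow at most like
`A ^ (2 * m)`. -/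
lemma exists_nat_convergent {p : ℕ} {A : ℝ} (hA1 : 1 ≤ A) (hA : (p : ℝ) ≤ A) {a : ℕ → ℚ}
    (ha : ∀ i, a i ∈ Sp p) (hden : ∀ i, ((a i).den : ℝ) ≤ A) {G : ℕ → ℚ}
    (h0 : G 0 = 0 ∨ G 0 = 1) (h1 : G 1 = 1 ∨ G 1 = a 0)
    (hG : ∀ m, G (m + 2) = a (m + 1) * G (m + 1) + G m) (m : ℕ) :
    ∃ z : ℕ, (z : ℚ) = (∏ j ∈ range m, ((a j).den : ℚ)) * G m ∧ (z : ℝ) ≤ A ^ (2 * m) := by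
  have hnum : ∀ i, ((a i).num.toNat : ℚ) = (a i).den * a i ∧
      ((a i).num.toNat : ℝ) + 1 ≤ (a i).den * p := by
    intro i
    have hz : ((a i).num.toNat : ℤ) = (a i).num := Int.toNat_of_nonneg (num_nonneg_of_mem (ha i))
    constructor
    · rw [mul_comm, Rat.mul_den_eq_num, ← Int.cast_natCast, hz]
    · have h2 : ((a i).num.toNat : ℤ) + 1 ≤ (a i).den * p := by
        rw [hz, mul_comm]; exact num_lt_of_mem (ha i)
      exact_mod_cast h2
  have hdp : ∀ i, ((a i).den : ℝ) * p ≤ A ^ 2 := fun i => by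
    rw [sq]; exact mul_le_mul (hden i) hA (Nat.cast_nonneg _) (by linarith)
  induction m using Nat.twoStepInduction with
  | zero =>
    obtain h0 | h0 := h0
    · exact ⟨0, by simp [h0], by simp⟩
    · exact ⟨1, by simp [h0], by simp⟩
  | one =>
    obtain h1 | h1 := h1
    · refine ⟨(a 0).den, by simp [h1], (hden 0).trans ?_⟩
      rw [mul_one, sq]
      exact le_mul_of_one_le_left (by linarith) hA1
    · refine ⟨(a 0).num.toNat, by simp [h1, (hnum 0).1], ?_⟩
      rw [mul_one]
      linarith [(hnum 0).2, hdp 0]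
  | more m ih1 ih2 =>
    obtain ⟨z, hz, hzA⟩ := ih1
    obtain ⟨y, hy, hyA⟩ := ih2
    refine ⟨(a (m + 1)).num.toNat * y + (a (m + 1)).den * (a m).den * z, ?_, ?_⟩
    · push_cast
      rw [(hnum _).1, hz, hy, hG, prod_range_succ _ (m + 1), prod_range_succ _ m]
      ring
    · push_cast
      have hA2 : (0 : ℝ) ≤ A ^ (2 * (m + 1)) := by positivity
      have h2 : ((a (m + 1)).den : ℝ) * (a m).den * z ≤ A ^ (2 * (m + 1)) := by
        calc ((a (m + 1)).den : ℝ) * (a m).den * z ≤ A * A * A ^ (2 * m) := by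
              gcongr
              · exact hden _
              · exact hden _
          _ = _ := by ring
      have h3 : ((a (m + 1)).num.toNat : ℝ) * y ≤
          ((a (m + 1)).den * p - 1) * A ^ (2 * (m + 1)) :=
        mul_le_mul (by linarith [(hnum (m + 1)).2]) hyA (Nat.cast_nonneg _)
          (by linarith [(hnum (m + 1)).2, (Nat.cast_nonneg _ : (0 : ℝ) ≤ (a (m + 1)).num.toNat)])
      have h4 := mul_le_mul_of_nonneg_right (hdp (m + 1)) hA2
      have h5 : A ^ (2 * (m + 1 + 1)) = A ^ 2 * A ^ (2 * (m + 1)) := by ring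
      rw [h5]
      linarith

lemma exists_int_convergent_sub {p : ℕ} {A : ℝ} (hA1 : 1 ≤ A) (hA : (p : ℝ) ≤ A) {a : ℕ → ℚ}
    (ha : ∀ i, a i ∈ Sp p) (hden : ∀ i, ((a i).den : ℝ) ≤ A) {G : ℕ → ℚ}
    (h0 : G 0 = 0 ∨ G 0 = 1) (h1 : G 1 = 1 ∨ G 1 = a 0)
    (hG : ∀ m, G (m + 2) = a (m + 1) * G (m + 1) + G m) (m : ℕ) :
    ∃ u : ℤ, (u : ℚ) = (∏ j ∈ range (m + 1), ((a j).den : ℚ)) * (G (m + 1) - p * G m) ∧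
      (u.natAbs : ℝ) ≤ A ^ (2 * (m + 1)) := by
  obtain ⟨z, hz, hzA⟩ := exists_nat_convergent hA1 hA ha hden h0 h1 hG m
  obtain ⟨y, hy, hyA⟩ := exists_nat_convergent hA1 hA ha hden h0 h1 hG (m + 1)
  refine ⟨(y : ℤ) - (p * (a m).den * z : ℕ), ?_, ?_⟩
  · push_cast
    rw [hz, hy, prod_range_succ]
    ring
  · rw [Nat.cast_natAbs]
    push_cast
    have h2 : (p : ℝ) * (a m).den * z ≤ A ^ (2 * (m + 1)) := by
      calc (p : ℝ) * (a m).den * z ≤ A * A * A ^ (2 * m) := by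
            gcongr
            exact hden m
        _ = _ := by ring
    have h3 : (0 : ℝ) ≤ (p : ℝ) * (a m).den * z := by positivity
    have h4 : (0 : ℝ) ≤ y := Nat.cast_nonneg y
    rw [abs_le]
    constructor <;> linarith

section Ruban

variable {p : ℕ} [hp : Fact p.Prime]

/-- The value at the index `m` of the rational number whose Ruban expansion agrees with `a` up to
the index `m` and has all later partial quotients equal to `p - p⁻¹`. -/
def blockValue (p : ℕ) (a : ℕ → ℚ) (m : ℕ) : ℚ :=
  (rubanR a (m + 1) - p * rubanR a m) / (rubanQ a (m + 1) - p * rubanQ a m)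

lemma isConvergents_ruban {a : ℕ → ℚ} (ha : ∀ i, 1 ≤ i → a i ∈ Sp' p) :
    IsConvergents (fun m => (a m : ℚ_[p])) (fun m => (rubanQ a m : ℚ_[p]))
      (fun m => (rubanR a m : ℚ_[p])) where
  norm_ge m hm := norm_ge_of_mem (ha m hm)
  den_zero := by simp [rubanQ]
  den_one := by simp [rubanQ]
  num_zero := by simp [rubanR]
  den_rec m := by simp only [rubanQ]; push_cast; rfl
  num_rec m := by simp only [rubanR]; push_cast; rfl

lemma cast_blockValue (a : ℕ → ℚ) (m : ℕ) : (blockValue p a m : ℚ_[p]) =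
    (rubanR a (m + 1) - p * rubanR a m) / (rubanQ a (m + 1) - p * rubanQ a m) := by
  rw [blockValue]; push_cast; rfl

lemma ht_int_mul_blockValue_le {A : ℝ} (hA : (p : ℝ) ≤ A) {a : ℕ → ℚ} (ha0 : a 0 ∈ Sp p)
    (ha : ∀ i, 1 ≤ i → a i ∈ Sp' p) (hbound : ∀ i, (padicNorm p (a i) : ℝ) ≤ A) {c : ℤ}
    (hc : c ≠ 0) (m : ℕ) : (ht (c * blockValue p a m) : ℝ) ≤ c.natAbs * A ^ (2 * (m + 1)) := by
  have hp1 : (1 : ℝ) < p := by exact_mod_cast hp.out.one_lt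
  have hA1 : 1 ≤ A := by linarith
  have haS : ∀ i, a i ∈ Sp p := fun i => by
    obtain rfl | hi := Nat.eq_zero_or_pos i
    · exact ha0
    · exact (ha i hi).1
  have hden : ∀ i, ((a i).den : ℝ) ≤ A := by
    intro i
    by_cases h1 : (a i).den = 1
    · rw [h1]; exact_mod_cast hA1
    · rw [← norm_eq_den (haS i) h1, Padic.eq_padicNorm]; exact hbound i
  obtain ⟨u, hu, huA⟩ := exists_int_convergent_sub hA1 hA haS hden (G := rubanR a)
    (Or.inr rfl) (Or.inr rfl) (fun _ => rfl) m
  obtain ⟨v, hv, hvA⟩ := exists_int_convergent_sub hA1 hA haS hden (G := rubanQ a)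
    (Or.inl rfl) (Or.inl rfl) (fun _ => rfl) m
  have hprod : ∏ j ∈ range (m + 1), ((a j).den : ℚ) ≠ 0 :=
    prod_ne_zero_iff.mpr fun j _ => by exact_mod_cast (a j).den_ne_zero
  have hD : rubanQ a (m + 1) - p * rubanQ a m ≠ 0 := by
    have := (isConvergents_ruban ha).den_sub_ne_zero m
    exact_mod_cast this
  have hv0 : v ≠ 0 := by
    have : (v : ℚ) ≠ 0 := hv ▸ mul_ne_zero hprod hD
    exact_mod_cast this
  have heq : (c : ℚ) * blockValue p a m = ((c * u : ℤ) : ℚ) / v := by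
    rw [blockValue, Int.cast_mul, hu, hv, mul_div_assoc, mul_div_mul_left _ _ hprod]
  have hcR : (1 : ℝ) ≤ c.natAbs := by exact_mod_cast Int.natAbs_pos.mpr hc
  have hle : (ht (c * blockValue p a m) : ℝ) ≤ max ((c * u).natAbs : ℝ) v.natAbs := by
    rw [heq]; exact_mod_cast ht_div_le hv0
  refine hle.trans (max_le ?_ (hvA.trans (le_mul_of_one_le_left (by positivity) hcR)))
  rw [Int.natAbs_mul]
  push_cast
  gcongr

/-- A Ruban continued fraction whose value coincides with that of an expansion ending in the
constant sequence `p - p⁻¹` is ultimately periodic. -/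
lemma ultimatelyPeriodic_of_eq_blockValue {a : ℕ → ℚ} (ha : ∀ i, 1 ≤ i → a i ∈ Sp' p)
    {α : ℚ_[p]} (hα : IsRubanValue p a α) {m : ℕ} (hm : α = blockValue p a m) :
    UltimatelyPeriodic a := by
  have hconv := isConvergents_ruban ha
  have hlim : Tendsto (fun m => (rubanR a (m + 1) : ℚ_[p]) / (rubanQ a (m + 1) : ℚ_[p])) atTop
      (nhds α) := by
    have := hα
    simp only [IsRubanValue, Rat.cast_div] at this
    exact this
  have hall : ∀ j, m < j → a j = p - (p : ℚ)⁻¹ := by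
    intro j
    induction j using Nat.strong_induction_on with
    | _ j ih =>
      intro hj
      obtain ⟨M, rfl⟩ : ∃ M, j = M + 1 := ⟨j - 1, by omega⟩
      have h1 := hconv.block_div_const (m := m) (M := M) (by omega) fun i hi hiM => by
        rw [ih i (by omega) hi]; push_cast; rfl
      refine eq_sub_inv_of_norm_le (ha _ (by omega)) (hconv.norm_one_add_mul_le hlim (m := M) ?_)
      rw [hm, cast_blockValue, h1]
  refine ⟨m + 1, 1, le_rfl, fun j hj => ?_⟩
  rw [hall j (by omega), hall (j + 1) (by omega)]

lemma inv_pow_le_exp {b C A H δ : ℝ} {n M : ℕ} (hb : 0 < b) (hC : 0 < C) (hA : 0 < A) (hH : 0 < H)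
    (hHle : H ≤ C * A ^ (2 * n)) (hδ : 0 ≤ 2 + δ)
    (h : (2 + δ) * (Real.log C + 2 * n * Real.log A) ≤ 2 * M * Real.log b) :
    ((b ^ M) ^ 2)⁻¹ ≤ Real.exp (-(2 + δ) * Real.log H) := by
  have h1 : Real.log H ≤ Real.log C + 2 * n * Real.log A := by
    refine (Real.log_le_log hH hHle).trans_eq ?_
    rw [Real.log_mul hC.ne' (by positivity), Real.log_pow]
    push_cast
    ring
  have h2 : ((b ^ M) ^ 2)⁻¹ = Real.exp (-(2 * M * Real.log b)) := by
    rw [Real.exp_neg, ← pow_mul, mul_comm M, ← Real.exp_log (pow_pos hb _), Real.log_pow]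
    push_cast
    rfl
  rw [h2, Real.exp_le_exp]
  have h3 := mul_le_mul_of_nonneg_left h1 hδ
  linarith

end Ruban

end Roth

open Roth

/-- **Theorem 1 (main theorem).** A quasi-periodic, non-ultimately-periodic Ruban continued
fraction with partial quotients bounded by `A` in `p`-adic absolute value, whose repeated
blocks are blocks of `p - p⁻¹` infinitely often, and whose quasi-period lengths grow fast
enough, has transcendental value. -/
theorem ruban_quasiPeriodic_transcendental
    (p : ℕ) [Fact p.Prime] (A : ℝ) (hA : (p : ℝ) ≤ A)
    (a : ℕ → ℚ) (ha0 : a 0 ∈ Sp p) (ha : ∀ i, 1 ≤ i → a i ∈ Sp' p)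
    (n lam k : ℕ → ℕ)
    (hmono : StrictMono n) (hpos : 1 ≤ n 0)
    (hlam : ∀ i, 1 ≤ lam i) (hk : ∀ i, 1 ≤ k i)
    (hqp1 : ∀ i, n i + lam i * k i ≤ n (i + 1))
    (hqp2 : ∀ i m, n i ≤ m → m + 1 ≤ n i + (lam i - 1) * k i → a (m + k i) = a m)
    (hbound : ∀ i, (padicNorm p (a i) : ℝ) ≤ A)
    (hnper : ¬ UltimatelyPeriodic a)
    (hblocks : ∃ᶠ i in Filter.atTop, ∀ j, j < k i → a (n i + j) = (p : ℚ) - (p : ℚ)⁻¹)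
    (hliminf : 2 * Real.log A / Real.log p - 1 <
      Filter.liminf (fun i => (lam i : ℝ) / (n i : ℝ)) Filter.atTop)
    (α : ℚ_[p]) (hα : IsRubanValue p a α) :
    Transcendental ℚ α := by
  have hp : Fact p.Prime := inferInstance
  have hp1 : (1 : ℝ) < p := by exact_mod_cast hp.out.one_lt
  have hlogp : 0 < Real.log p := Real.log_pos hp1
  have hlogA : 0 < Real.log A := Real.log_pos (hp1.trans_le hA)
  have hconv := isConvergents_ruban ha
  have hlim : Tendsto (fun m => (rubanR a (m + 1) : ℚ_[p]) / (rubanQ a (m + 1) : ℚ_[p])) atTop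
      (nhds α) := by
    have := hα
    simp only [IsRubanValue, Rat.cast_div] at this
    exact this
  have hn0 : ∀ i, 1 ≤ n i := fun i => hpos.trans (hmono.monotone (Nat.zero_le i))
  have hblock : ∀ i, (∀ j, j < k i → a (n i + j) = (p : ℚ) - (p : ℚ)⁻¹) →
      ∀ j, j < lam i * k i → a (n i + j) = (p : ℚ) - (p : ℚ)⁻¹ := by
    intro i hi j
    induction j using Nat.strong_induction_on with
    | _ j ih =>
      intro hj
      by_cases hjk : j < k i
      · exact hi j hjk
      · have h1 := hqp2 i (n i + (j - k i)) (by omega) (by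
          rw [Nat.sub_mul, one_mul]; omega)
        rw [show n i + (j - k i) + k i = n i + j by omega] at h1
        rw [h1]
        exact ih _ (by have := hk i; omega) (by omega)
  have happrox : ∀ i, (∀ j, j < k i → a (n i + j) = (p : ℚ) - (p : ℚ)⁻¹) →
      ‖α - (blockValue p a (n i - 1) : ℚ_[p])‖ ≤ (((p : ℝ) ^ (n i + lam i - 1)) ^ 2)⁻¹ := by
    intro i hi
    have hle : lam i ≤ lam i * k i := Nat.le_mul_of_pos_right _ (hk i)
    have h1 := hconv.block_div_const (m := n i - 1) (M := n i + lam i - 1) (by omega)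
      fun j hj hjM => by
        have h2 := hblock i hi (j - n i) (by have := hn0 i; omega)
        rw [show n i + (j - n i) = j by omega] at h2
        rw [h2]; push_cast; rfl
    rw [cast_blockValue, ← h1]
    exact hconv.norm_limit_sub_block_le hlim _
  intro halg
  obtain ⟨c, hc, hcint⟩ := IsAlgebraic.exists_integral_multiple
    ((IsFractionRing.isAlgebraic_iff ℤ ℚ ℚ_[p]).mpr halg)
  have hc' : (c : ℚ_[p]) ≠ 0 := by exact_mod_cast hc
  rw [zsmul_eq_mul] at hcint
  obtain ⟨x, hx1, hx2⟩ := exists_between hliminf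
  have hlamx := eventually_lt_of_lt_liminf hx2
    (isBoundedUnder_of ⟨0, fun i => by positivity⟩)
  have hxlog : 2 * Real.log A < (x + 1) * Real.log p := by
    rwa [sub_lt_iff_lt_add, div_lt_iff₀ hlogp] at hx1
  obtain ⟨δ, hδ, hδlog⟩ : ∃ δ : ℝ, 0 < δ ∧ (2 + δ) * Real.log A < (x + 1) * Real.log p := by
    obtain ⟨y, hy1, hy2⟩ := exists_between hxlog
    refine ⟨y / Real.log A - 2, ?_, ?_⟩
    · rw [sub_pos, lt_div_iff₀ hlogA]; exact hy1
    · rw [add_sub_cancel, div_mul_cancel₀ _ hlogA.ne']; exact hy2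
  have hfin := finite_setOf_norm_sub_le hcint hδ
  have hntop : Tendsto (fun i => (n i : ℝ)) atTop atTop :=
    tendsto_natCast_atTop_atTop.comp hmono.tendsto_atTop
  have hgrow : ∀ᶠ i in atTop, (2 + δ) * (Real.log c.natAbs + 2 * n i * Real.log A) ≤
      2 * (n i + lam i - 1 : ℕ) * Real.log p := by
    have hgap : 0 < (x + 1) * Real.log p - (2 + δ) * Real.log A := sub_pos.mpr hδlog
    filter_upwards [hlamx, hntop.eventually_ge_atTop (((2 + δ) * Real.log c.natAbs +
      2 * Real.log p) / (2 * ((x + 1) * Real.log p - (2 + δ) * Real.log A)))] with i h1 h2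
    have hni : (0 : ℝ) < n i := by exact_mod_cast hn0 i
    rw [lt_div_iff₀ hni] at h1
    rw [div_le_iff₀ (by positivity)] at h2
    rw [Nat.cast_sub (by have := hn0 i; omega)]
    push_cast at h2 ⊢
    have h3 := mul_le_mul_of_nonneg_right h1.le hlogp.le
    linarith
  have hmem : ∃ᶠ i in atTop, (c : ℚ) * blockValue p a (n i - 1) ∈
      {β : ℚ | ‖c * α - (β : ℚ_[p])‖ ≤ Real.exp (-(2 + δ) * Real.log (ht β))} ∧
      ‖c * α - ((c * blockValue p a (n i - 1) : ℚ) : ℚ_[p])‖ ≤ (n i : ℝ)⁻¹ := by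
    refine (hblocks.and_eventually hgrow).mono fun i ⟨hi, hgi⟩ => ?_
    have h1 : ‖c * α - ((c * blockValue p a (n i - 1) : ℚ) : ℚ_[p])‖ ≤
        (((p : ℝ) ^ (n i + lam i - 1)) ^ 2)⁻¹ := by
      push_cast
      rw [← mul_sub, norm_mul]
      exact (mul_le_of_le_one_left (norm_nonneg _) (Padic.norm_int_le_one c)).trans (happrox i hi)
    refine ⟨h1.trans ?_, h1.trans ?_⟩
    · have h2 := ht_int_mul_blockValue_le hA ha0 ha hbound hc (n i - 1)
      rw [Nat.sub_add_cancel (hn0 i)] at h2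
      exact inv_pow_le_exp (by linarith) (by exact_mod_cast Int.natAbs_pos.mpr hc) (by linarith)
        (by exact_mod_cast ht_pos _) h2 (by linarith) hgi
    · have hni : (0 : ℝ) < n i := by exact_mod_cast hn0 i
      refine inv_anti₀ hni ?_
      have h2 : n i < p ^ n i := Nat.lt_pow_self hp.out.one_lt
      have h3 : p ^ n i ≤ (p ^ (n i + lam i - 1)) ^ 2 := by
        rw [← pow_mul]
        refine Nat.pow_le_pow_right hp.out.pos ?_
        have := hlam i
        omega
      exact_mod_cast (h2.trans_le h3).le
  obtain ⟨γ, -, hγ⟩ : ∃ γ ∈ {β : ℚ | ‖c * α - (β : ℚ_[p])‖ ≤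
      Real.exp (-(2 + δ) * Real.log (ht β))}, ∃ᶠ i in atTop,
      (c : ℚ) * blockValue p a (n i - 1) = γ ∧ ‖c * α - (γ : ℚ_[p])‖ ≤ (n i : ℝ)⁻¹ := by
    by_contra! hcon
    have hcon' := (hfin.eventually_all (l := atTop)).mpr hcon
    obtain ⟨i, hi, hi'⟩ := (hmem.and_eventually hcon').exists
    exact (hi' _ hi.1 rfl).not_ge hi.2
  have hγα : c * α = (γ : ℚ_[p]) := by
    rw [← sub_eq_zero, ← norm_le_zero_iff]
    exact ge_of_tendsto_of_frequently (tendsto_inv_atTop_zero.comp hntop)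
      (hγ.mono fun i hi => hi.2)
  obtain ⟨i, hi, -⟩ := hγ.exists
  refine hnper (ultimatelyPeriodic_of_eq_blockValue ha hα (m := n i - 1) ?_)
  rw [← hi] at hγα
  push_cast at hγα
  exact mul_left_cancel₀ hc' hγα
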